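/- arXiv:2603.11822 — 2 statements merged into one kernel-verified Lean document; each statement's English description precedes it below -/
import Mathlib

section
/- Let X be a non-linear carpet satisfying the coordinate open set condition. Then dim_H X = lim_{n→∞} max_{p ∈ 𝒫(Λⁿ)} g(p, a_n, b_n), where Λⁿ is identified with a subset of Λ₁ⁿ × Λ₂ⁿ via coordinate projections; in particular the limit exists and the maximum is attained for each n. -/
open Set Filter MeasureTheory Metric
open scoped ENNReal NNReal

noncomputable section

/-- Composition of the maps of an IFS along a finite word (in order). -/
def compWord {Λ : Type*} (f : Λ → ℝ → ℝ) : List Λ → ℝ → ℝ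
  | [] => id
  | i :: w => f i ∘ compWord f w

/-- The chain-rule derivative of `compWord f w`, expressed via the derivatives `f'`. -/
def wordDeriv {Λ : Type*} (f f' : Λ → ℝ → ℝ) : List Λ → ℝ → ℝ
  | [] => fun _ => 1
  | i :: w => fun x => f' i (compWord f w x) * wordDeriv f f' w x

/-- `‖f_w'‖`: the sup over `[0,1]` of `|f_w'|`. -/
def wordDerivNorm {Λ : Type*} (f f' : Λ → ℝ → ℝ) (w : List Λ) : ℝ :=
  sSup ((fun x => |wordDeriv f f' w x|) '' Icc (0:ℝ) 1)

/-- A self-conformal IFS on `[0,1]`: finitely many uniformly contracting differentiable maps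
with Hölder continuous non-vanishing derivatives. -/
structure ConformalIFS (Λ : Type*) where
  f : Λ → ℝ → ℝ
  f' : Λ → ℝ → ℝ
  mapsTo : ∀ i, MapsTo (f i) (Icc (0:ℝ) 1) (Icc (0:ℝ) 1)
  hasDeriv : ∀ i, ∀ x ∈ Icc (0:ℝ) 1, HasDerivWithinAt (f i) (f' i x) (Icc (0:ℝ) 1) x
  exponent : ℝ
  exponent_pos : 0 < exponent
  holder : ∀ i, ∃ C : ℝ, ∀ x ∈ Icc (0:ℝ) 1, ∀ y ∈ Icc (0:ℝ) 1,
    |f' i x - f' i y| ≤ C * |x - y| ^ exponent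
  nonvanishing : ∀ i, ∀ x ∈ Icc (0:ℝ) 1, f' i x ≠ 0
  ratio : ℝ
  ratio_pos : 0 < ratio
  ratio_lt_one : ratio < 1
  contracting : ∀ i, ∀ x ∈ Icc (0:ℝ) 1, ∀ y ∈ Icc (0:ℝ) 1, |f i x - f i y| ≤ ratio * |x - y|

/-- The open set condition (with an open subset of `[0,1]`) for a conformal IFS. -/
def CoordOSC {Λ : Type*} (F : ConformalIFS Λ) : Prop :=
  ∃ U : Set ℝ, U.Nonempty ∧ U ⊆ Icc 0 1 ∧ (∃ O : Set ℝ, IsOpen O ∧ U = O ∩ Icc 0 1) ∧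
    (∀ i, F.f i '' U ⊆ U) ∧ Pairwise fun i i' => Disjoint (F.f i '' U) (F.f i' '' U)

end
noncomputable section

/-- The planar map `S_{(i,j)}(x,y) = (f_i(x), g_j(y))`. -/
def carpetMap {Λ₁ Λ₂ : Type*} (F : ConformalIFS Λ₁) (G : ConformalIFS Λ₂)
    (ij : Λ₁ × Λ₂) (p : ℝ × ℝ) : ℝ × ℝ :=
  (F.f ij.1 p.1, G.f ij.2 p.2)

/-- `X` is the attractor (a non-linear carpet) of the IFS `(S_{(i,j)})_{(i,j) ∈ A}`. -/
def IsCarpetAttractor {Λ₁ Λ₂ : Type*} (F : ConformalIFS Λ₁) (G : ConformalIFS Λ₂)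
    (A : Set (Λ₁ × Λ₂)) (X : Set (ℝ × ℝ)) : Prop :=
  X.Nonempty ∧ IsCompact X ∧ X ⊆ Icc (0:ℝ) 1 ×ˢ Icc (0:ℝ) 1 ∧
    X = ⋃ ij ∈ A, carpetMap F G ij '' X

/-- `p` is a probability vector indexed by `A` (entries outside `A` vanish). -/
def IsProbVec {Γ₁ Γ₂ : Type*} [Fintype Γ₁] [Fintype Γ₂] (A : Set (Γ₁ × Γ₂))
    (p : Γ₁ × Γ₂ → ℝ) : Prop :=
  (∀ ij, 0 ≤ p ij) ∧ (∀ ij ∉ A, p ij = 0) ∧ ∑ ij : Γ₁ × Γ₂, p ij = 1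

/-- Column sums `q_i(p)`. -/
def colSum {Γ₁ Γ₂ : Type*} [Fintype Γ₂] (p : Γ₁ × Γ₂ → ℝ) (i : Γ₁) : ℝ := ∑ j : Γ₂, p (i, j)

/-- Row sums `r_j(p)`. -/
def rowSum {Γ₁ Γ₂ : Type*} [Fintype Γ₁] (p : Γ₁ × Γ₂ → ℝ) (j : Γ₂) : ℝ := ∑ i : Γ₁, p (i, j)

/-- The first Lyapunov exponent `λ₁(p,a)`. -/
def lyap1 {Γ₁ Γ₂ : Type*} [Fintype Γ₁] [Fintype Γ₂] (p : Γ₁ × Γ₂ → ℝ) (a : Γ₁ → ℝ) : ℝ :=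
  ∑ ij : Γ₁ × Γ₂, p ij * Real.log (a ij.1)

/-- The second Lyapunov exponent `λ₂(p,b)`. -/
def lyap2 {Γ₁ Γ₂ : Type*} [Fintype Γ₁] [Fintype Γ₂] (p : Γ₁ × Γ₂ → ℝ) (b : Γ₂ → ℝ) : ℝ :=
  ∑ ij : Γ₁ × Γ₂, p ij * Real.log (b ij.2)

/-- `g₁(p,a,b)`. -/
def gOne {Γ₁ Γ₂ : Type*} [Fintype Γ₁] [Fintype Γ₂] (p : Γ₁ × Γ₂ → ℝ) (a : Γ₁ → ℝ)
    (b : Γ₂ → ℝ) : ℝ :=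
  (∑ ij : Γ₁ × Γ₂, p ij * Real.log (colSum p ij.1)) / lyap1 p a +
    ((∑ ij : Γ₁ × Γ₂, p ij * Real.log (p ij)) -
      ∑ ij : Γ₁ × Γ₂, p ij * Real.log (colSum p ij.1)) / lyap2 p b

/-- `g₂(p,a,b)`. -/
def gTwo {Γ₁ Γ₂ : Type*} [Fintype Γ₁] [Fintype Γ₂] (p : Γ₁ × Γ₂ → ℝ) (a : Γ₁ → ℝ)
    (b : Γ₂ → ℝ) : ℝ :=
  (∑ ij : Γ₁ × Γ₂, p ij * Real.log (rowSum p ij.2)) / lyap2 p b +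
    ((∑ ij : Γ₁ × Γ₂, p ij * Real.log (p ij)) -
      ∑ ij : Γ₁ × Γ₂, p ij * Real.log (rowSum p ij.2)) / lyap1 p a

/-- `g(p,a,b)`: equal to `g₁` when `λ₁(p,a) ≥ λ₂(p,b)` and to `g₂` otherwise. -/
noncomputable def gFun {Γ₁ Γ₂ : Type*} [Fintype Γ₁] [Fintype Γ₂] (p : Γ₁ × Γ₂ → ℝ)
    (a : Γ₁ → ℝ) (b : Γ₂ → ℝ) : ℝ :=
  if lyap2 p b ≤ lyap1 p a then gOne p a b else gTwo p a b

/-- The alphabet `Λⁿ`, viewed as a subset of `Λ₁ⁿ × Λ₂ⁿ`. -/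
def blockAlphabet {Λ₁ Λ₂ : Type*} (A : Set (Λ₁ × Λ₂)) (n : ℕ) :
    Set ((Fin n → Λ₁) × (Fin n → Λ₂)) :=
  {w | ∀ k, (w.1 k, w.2 k) ∈ A}

/-! ### One-dimensional facts: chain rule and bounded distortion -/

theorem compWord_append {Λ : Type*} (f : Λ → ℝ → ℝ) (u v : List Λ) :
    compWord f (u ++ v) = compWord f u ∘ compWord f v := by
  induction u with
  | nil => rfl
  | cons i u ih => simp only [List.cons_append, compWord, ih]; rfl

theorem wordDeriv_append {Λ : Type*} (f f' : Λ → ℝ → ℝ) (u v : List Λ) (x : ℝ) :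
    wordDeriv f f' (u ++ v) x = wordDeriv f f' u (compWord f v x) * wordDeriv f f' v x := by
  induction u with
  | nil => simp [wordDeriv]
  | cons i u ih =>
    simp only [List.cons_append, wordDeriv, ih, compWord_append, Function.comp]
    ring

theorem compWord_mapsTo {Λ : Type*} (f : Λ → ℝ → ℝ)
    (hf : ∀ i, MapsTo (f i) (Icc (0:ℝ) 1) (Icc (0:ℝ) 1)) (w : List Λ) :
    MapsTo (compWord f w) (Icc (0:ℝ) 1) (Icc (0:ℝ) 1) := by
  induction w with
  | nil => exact fun x hx => hx
  | cons i w ih => exact (hf i).comp ih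

theorem compWord_hasDeriv {Λ : Type*} (F : ConformalIFS Λ) (w : List Λ) :
    ∀ x ∈ Icc (0:ℝ) 1,
      HasDerivWithinAt (compWord F.f w) (wordDeriv F.f F.f' w x) (Icc (0:ℝ) 1) x := by
  induction w with
  | nil => intro x hx; exact hasDerivWithinAt_id x _
  | cons i w ih =>
    intro x hx
    exact (F.hasDeriv i _ (compWord_mapsTo F.f F.mapsTo w hx)).comp x (ih x hx)
      (compWord_mapsTo F.f F.mapsTo w)

theorem compWord_ratio {Λ : Type*} (F : ConformalIFS Λ) (w : List Λ) :
    ∀ x ∈ Icc (0:ℝ) 1, ∀ y ∈ Icc (0:ℝ) 1,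
      |compWord F.f w x - compWord F.f w y| ≤ F.ratio ^ w.length * |x - y| := by
  induction w with
  | nil => intro x _ y _; simp [compWord]
  | cons i w ih =>
    intro x hx y hy
    have h1 := F.contracting i _ (compWord_mapsTo F.f F.mapsTo w hx) _
      (compWord_mapsTo F.f F.mapsTo w hy)
    have h2 := mul_le_mul_of_nonneg_left (ih x hx y hy) F.ratio_pos.le
    simp only [compWord, Function.comp, List.length_cons]
    calc _ ≤ _ := h1
      _ ≤ _ := h2
      _ = _ := by ring

theorem deriv_le_ratio {Λ : Type*} (F : ConformalIFS Λ) (i : Λ) (x : ℝ)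
    (hx : x ∈ Icc (0:ℝ) 1) : |F.f' i x| ≤ F.ratio := by
  have h := (hasDerivWithinAt_iff_tendsto_slope.1 (F.hasDeriv i x hx)).abs
  have hacc : (nhdsWithin x (Icc (0:ℝ) 1 \ {x})).NeBot := by
    have := uniqueDiffOn_Icc (zero_lt_one (α := ℝ)) x hx
    exact accPt_principal_iff_nhdsWithin.1 (uniqueDiffWithinAt_iff_accPt.1 this)
  refine le_of_tendsto h ?_
  filter_upwards [self_mem_nhdsWithin] with y hy
  have h1 := F.contracting i y hy.1 x hx
  have hne : 0 < |y - x| := abs_pos.2 (sub_ne_zero.2 hy.2)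
  rw [slope_def_field, abs_div, div_le_iff₀ hne]
  exact h1

theorem wordDeriv_le {Λ : Type*} (F : ConformalIFS Λ) (w : List Λ) (x : ℝ)
    (hx : x ∈ Icc (0:ℝ) 1) : |wordDeriv F.f F.f' w x| ≤ F.ratio ^ w.length := by
  induction w with
  | nil => simp [wordDeriv]
  | cons i w ih =>
    simp only [wordDeriv, abs_mul, List.length_cons, pow_succ']
    exact mul_le_mul (deriv_le_ratio F i _ (compWord_mapsTo F.f F.mapsTo w hx)) ih
      (abs_nonneg _) F.ratio_pos.le

theorem wordDeriv_ne {Λ : Type*} (F : ConformalIFS Λ) (w : List Λ) (x : ℝ)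
    (hx : x ∈ Icc (0:ℝ) 1) : wordDeriv F.f F.f' w x ≠ 0 := by
  induction w with
  | nil => simp [wordDeriv]
  | cons i w ih =>
    exact mul_ne_zero (F.nonvanishing i _ (compWord_mapsTo F.f F.mapsTo w hx)) ih

theorem wordDeriv_bdd {Λ : Type*} (F : ConformalIFS Λ) (w : List Λ) :
    BddAbove ((fun x => |wordDeriv F.f F.f' w x|) '' Icc (0:ℝ) 1) := by
  refine ⟨F.ratio ^ w.length, ?_⟩
  rintro _ ⟨x, hx, rfl⟩
  exact wordDeriv_le F w x hx

theorem le_wordDerivNorm {Λ : Type*} (F : ConformalIFS Λ) (w : List Λ) (x : ℝ)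
    (hx : x ∈ Icc (0:ℝ) 1) : |wordDeriv F.f F.f' w x| ≤ wordDerivNorm F.f F.f' w :=
  le_csSup (wordDeriv_bdd F w) ⟨x, hx, rfl⟩

theorem wordDerivNorm_le {Λ : Type*} (F : ConformalIFS Λ) (w : List Λ) (B : ℝ)
    (h : ∀ x ∈ Icc (0:ℝ) 1, |wordDeriv F.f F.f' w x| ≤ B) : wordDerivNorm F.f F.f' w ≤ B := by
  refine csSup_le ⟨_, 0, by simp, rfl⟩ ?_
  rintro _ ⟨x, hx, rfl⟩
  exact h x hx

theorem wordDerivNorm_pos {Λ : Type*} (F : ConformalIFS Λ) (w : List Λ) :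
    0 < wordDerivNorm F.f F.f' w :=
  (abs_pos.2 (wordDeriv_ne F w 0 (by simp))).trans_le (le_wordDerivNorm F w 0 (by simp))

theorem wordDerivNorm_le_ratio {Λ : Type*} (F : ConformalIFS Λ) (w : List Λ) :
    wordDerivNorm F.f F.f' w ≤ F.ratio ^ w.length :=
  wordDerivNorm_le F w _ (wordDeriv_le F w)

/-- Mean value theorem for compositions. -/
theorem compWord_mvt {Λ : Type*} (F : ConformalIFS Λ) (w : List Λ) (x y : ℝ)
    (hx : x ∈ Icc (0:ℝ) 1) (hy : y ∈ Icc (0:ℝ) 1) :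
    ∃ z ∈ Icc (0:ℝ) 1, |compWord F.f w x - compWord F.f w y| =
      |wordDeriv F.f F.f' w z| * |x - y| := by
  wlog hxy : x < y generalizing x y
  · rcases eq_or_lt_of_le (not_lt.1 hxy) with h | h
    · exact ⟨x, hx, by simp [h]⟩
    · obtain ⟨z, hz, h⟩ := this y x hy hx h
      exact ⟨z, hz, by rw [abs_sub_comm, h, abs_sub_comm x y]⟩
  have hsub : Icc x y ⊆ Icc (0:ℝ) 1 := Icc_subset_Icc hx.1 hy.2
  obtain ⟨z, hz, h⟩ := exists_hasDerivAt_eq_slope (compWord F.f w) (wordDeriv F.f F.f' w) hxy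
    (fun t ht => ((compWord_hasDeriv F w t (hsub ht)).continuousWithinAt).mono hsub)
    (fun t ht => (compWord_hasDeriv F w t (hsub (Ioo_subset_Icc_self ht))).hasDerivAt
      (Icc_mem_nhds (hx.1.trans_lt ht.1) (ht.2.trans_le hy.2)))
  refine ⟨z, hsub (Ioo_subset_Icc_self hz), ?_⟩
  have : 0 < y - x := by linarith
  rw [h, ← abs_mul, abs_sub_comm, ← abs_neg ((_ / _) * _)]
  congr 1
  field_simp
  ring

theorem compWord_lip {Λ : Type*} (F : ConformalIFS Λ) (w : List Λ) (x y : ℝ)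
    (hx : x ∈ Icc (0:ℝ) 1) (hy : y ∈ Icc (0:ℝ) 1) :
    |compWord F.f w x - compWord F.f w y| ≤ wordDerivNorm F.f F.f' w * |x - y| := by
  obtain ⟨z, hz, h⟩ := compWord_mvt F w x y hx hy
  rw [h]
  exact mul_le_mul_of_nonneg_right (le_wordDerivNorm F w z hz) (abs_nonneg _)

/-- Uniform Hölder control of `log |f_i'|`. -/
theorem single_distortion {Λ : Type*} [Finite Λ] (F : ConformalIFS Λ) :
    ∃ C : ℝ, 0 ≤ C ∧ ∀ i, ∀ x ∈ Icc (0:ℝ) 1, ∀ y ∈ Icc (0:ℝ) 1,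
      |F.f' i x| ≤ Real.exp (C * |x - y| ^ F.exponent) * |F.f' i y| := by
  have key : ∀ i, ∃ C : ℝ, 0 ≤ C ∧ ∀ x ∈ Icc (0:ℝ) 1, ∀ y ∈ Icc (0:ℝ) 1,
      |F.f' i x| ≤ Real.exp (C * |x - y| ^ F.exponent) * |F.f' i y| := by
    intro i
    obtain ⟨C, hC⟩ := F.holder i
    have hcont : ContinuousOn (fun x => |F.f' i x|) (Icc (0:ℝ) 1) := by
      refine ContinuousOn.abs ?_
      intro x hx
      have h0 : Tendsto (fun y : ℝ => C * |y - x| ^ F.exponent) (nhdsWithin x (Icc 0 1))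
          (nhds 0) := by
        have : Continuous (fun y : ℝ => C * |y - x| ^ F.exponent) :=
          continuous_const.mul ((continuous_id.sub continuous_const).abs.rpow_const
            (fun _ => Or.inr F.exponent_pos.le))
        have h := (this.tendsto x).mono_left (nhdsWithin_le_nhds (s := Icc (0:ℝ) 1))
        simpa [Real.zero_rpow F.exponent_pos.ne'] using h
      refine tendsto_iff_dist_tendsto_zero.2 (squeeze_zero' (Eventually.of_forall
        fun _ => dist_nonneg) ?_ h0)
      filter_upwards [self_mem_nhdsWithin] with y hy
      rw [Real.dist_eq]
      exact hC y hy x hx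
    obtain ⟨z, hz, hmin⟩ := isCompact_Icc.exists_isMinOn (nonempty_Icc.2 zero_le_one) hcont
    have hm : 0 < |F.f' i z| := abs_pos.2 (F.nonvanishing i z hz)
    set m := |F.f' i z|
    refine ⟨|C| / m, by positivity, fun x hx y hy => ?_⟩
    have hmy : m ≤ |F.f' i y| := hmin hy
    have h1 : |F.f' i x| ≤ |F.f' i y| + |C| * |x - y| ^ F.exponent := by
      have := hC x hx y hy
      have h2 := abs_sub_abs_le_abs_sub (F.f' i x) (F.f' i y)
      have h3 : C * |x - y| ^ F.exponent ≤ |C| * |x - y| ^ F.exponent :=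
        mul_le_mul_of_nonneg_right (le_abs_self C) (by positivity)
      linarith
    have hT : 0 ≤ |x - y| ^ F.exponent := by positivity
    set T := |x - y| ^ F.exponent
    have h4 : |C| / m * T + 1 ≤ Real.exp (|C| / m * T) := Real.add_one_le_exp _
    calc |F.f' i x| ≤ |F.f' i y| + |C| * T := h1
      _ = |F.f' i y| + |C| / m * T * m := by field_simp
      _ ≤ |F.f' i y| + |C| / m * T * |F.f' i y| := by gcongr
      _ = (|C| / m * T + 1) * |F.f' i y| := by ring
      _ ≤ _ := by gcongr
  choose C hC0 hC using key
  obtain ⟨B, hB⟩ := (Set.finite_range C).bddAbove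
  refine ⟨max B 0, le_max_right _ _, fun i x hx y hy => (hC i x hx y hy).trans ?_⟩
  have : C i ≤ max B 0 := (hB ⟨i, rfl⟩).trans (le_max_left _ _)
  gcongr

/-- Bounded distortion. -/
theorem distortion {Λ : Type*} [Finite Λ] (F : ConformalIFS Λ) :
    ∃ D : ℝ, 1 ≤ D ∧ ∀ w, ∀ x ∈ Icc (0:ℝ) 1, ∀ y ∈ Icc (0:ℝ) 1,
      |wordDeriv F.f F.f' w x| ≤ D * |wordDeriv F.f F.f' w y| := by
  obtain ⟨C, hC0, hC⟩ := single_distortion F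
  set κ := F.ratio ^ F.exponent
  have hκ0 : 0 ≤ κ := Real.rpow_nonneg F.ratio_pos.le _
  have hκ1 : κ < 1 := Real.rpow_lt_one F.ratio_pos.le F.ratio_lt_one F.exponent_pos
  have key : ∀ w : List Λ, ∀ x ∈ Icc (0:ℝ) 1, ∀ y ∈ Icc (0:ℝ) 1,
      |wordDeriv F.f F.f' w x| ≤
        Real.exp (C * ∑ k ∈ Finset.range w.length, κ ^ k) * |wordDeriv F.f F.f' w y| := by
    intro w
    induction w with
    | nil => intro x _ y _; simp [wordDeriv]
    | cons i w ih =>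
      intro x hx y hy
      have hx' := compWord_mapsTo F.f F.mapsTo w hx
      have hy' := compWord_mapsTo F.f F.mapsTo w hy
      have h1 := hC i _ hx' _ hy'
      have h2 : |compWord F.f w x - compWord F.f w y| ^ F.exponent ≤ κ ^ w.length := by
        have h3 := compWord_ratio F w x hx y hy
        have h4 : |x - y| ≤ 1 := by
          rw [abs_le]; constructor <;> linarith [hx.1, hx.2, hy.1, hy.2]
        have h5 : |compWord F.f w x - compWord F.f w y| ≤ F.ratio ^ w.length := by
          refine h3.trans (mul_le_of_le_one_right (pow_nonneg F.ratio_pos.le _) h4)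
        calc _ ≤ (F.ratio ^ w.length) ^ F.exponent :=
              Real.rpow_le_rpow (abs_nonneg _) h5 F.exponent_pos.le
          _ = κ ^ w.length := by
              rw [← Real.rpow_natCast, ← Real.rpow_natCast, ← Real.rpow_mul F.ratio_pos.le,
                ← Real.rpow_mul F.ratio_pos.le, mul_comm]
      have h6 : Real.exp (C * |compWord F.f w x - compWord F.f w y| ^ F.exponent) ≤
          Real.exp (C * κ ^ w.length) := by gcongr
      simp only [wordDeriv, abs_mul, List.length_cons, Finset.sum_range_succ, mul_add,
        Real.exp_add]
      calc _ ≤ (Real.exp (C * κ ^ w.length) * |F.f' i (compWord F.f w y)|) *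
            (Real.exp (C * ∑ k ∈ Finset.range w.length, κ ^ k) * |wordDeriv F.f F.f' w y|) := by
            refine mul_le_mul (h1.trans ?_) (ih x hx y hy) (abs_nonneg _) (by positivity)
            gcongr
        _ = _ := by ring
  refine ⟨Real.exp (C * (1 - κ)⁻¹), ?_, fun w x hx y hy => (key w x hx y hy).trans ?_⟩
  · apply Real.one_le_exp
    have : 0 < 1 - κ := by linarith
    positivity
  · have : ∑ k ∈ Finset.range w.length, κ ^ k ≤ (1 - κ)⁻¹ :=
      (summable_geometric_of_lt_one hκ0 hκ1).sum_le_tsum _ (fun _ _ => pow_nonneg hκ0 _)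
        |>.trans_eq (tsum_geometric_of_lt_one hκ0 hκ1)
    gcongr

/-! ### Upper bound: coverings -/

/-- The initial segment of length `k` of an infinite word. -/
def pre {Γ : Type*} (ω : ℕ → Γ) (k : ℕ) : List Γ := List.ofFn fun t : Fin k => ω t

theorem pre_succ {Γ : Type*} (ω : ℕ → Γ) (k : ℕ) : pre ω (k + 1) = pre ω k ++ [ω k] := by
  rw [pre, List.ofFn_succ_last]; rfl

theorem pre_add {Γ : Type*} (ω : ℕ → Γ) (k j : ℕ) :
    pre ω (k + j) = pre ω k ++ pre (fun t => ω (k + t)) j := by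
  simp [pre, List.ofFn_add]

theorem pre_length {Γ : Type*} (ω : ℕ → Γ) (k : ℕ) : (pre ω k).length = k := by simp [pre]

theorem pre_map_sum {Γ : Type*} (ω : ℕ → Γ) (k : ℕ) (h : Γ → ℝ) :
    ((pre ω k).map h).sum = ∑ t ∈ Finset.range k, h (ω t) := by
  rw [Finset.sum_range, pre, List.map_ofFn, List.sum_ofFn]; rfl

theorem compWord_lip_exp {Γ : Type*} (φ : Γ → ℝ → ℝ) (α : Γ → ℝ)
    (hφ : ∀ i, MapsTo (φ i) (Icc (0:ℝ) 1) (Icc (0:ℝ) 1))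
    (hl : ∀ i, ∀ x ∈ Icc (0:ℝ) 1, ∀ y ∈ Icc (0:ℝ) 1,
      |φ i x - φ i y| ≤ Real.exp (-α i) * |x - y|) (w : List Γ) :
    ∀ x ∈ Icc (0:ℝ) 1, ∀ y ∈ Icc (0:ℝ) 1,
      |compWord φ w x - compWord φ w y| ≤ Real.exp (-(w.map α).sum) * |x - y| := by
  induction w with
  | nil => intro x _ y _; simp [compWord]
  | cons i w ih =>
    intro x hx y hy
    have h1 := hl i _ (compWord_mapsTo φ hφ w hx) _ (compWord_mapsTo φ hφ w hy)
    have h2 := mul_le_mul_of_nonneg_left (ih x hx y hy) (Real.exp_pos (-α i)).le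
    simp only [compWord, Function.comp, List.map_cons, List.sum_cons, neg_add, Real.exp_add]
    calc _ ≤ _ := h1
      _ ≤ _ := h2
      _ = _ := by ring

theorem abs_sub_le_one {x y : ℝ} (hx : x ∈ Icc (0:ℝ) 1) (hy : y ∈ Icc (0:ℝ) 1) :
    |x - y| ≤ 1 := by
  rw [abs_le]; constructor <;> linarith [hx.1, hx.2, hy.1, hy.2]

/-- A Borel-Cantelli type lemma for Hausdorff measures. -/
theorem hausdorff_limsup_zero {ι : ℕ → Type} [∀ K, Fintype (ι K)] (d : ℝ) (hd : 0 < d)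
    (t : ∀ K, ι K → Set (ℝ × ℝ)) (S : ℕ → ℝ≥0∞) (hS : ∑' K, S K ≠ ⊤)
    (ht : ∀ K, ∑ i, ediam (t K i) ^ d ≤ S K) (Y : Set (ℝ × ℝ))
    (hY : ∀ x ∈ Y, ∀ N, ∃ K ≥ N, ∃ i, x ∈ t K i) : Measure.hausdorffMeasure d Y = 0 := by
  have htail := ENNReal.tendsto_sum_nat_add S hS
  have hsum : ∀ N, ∑' p : Σ K, ι (K + N), ediam (t (p.1 + N) p.2) ^ d ≤ ∑' K, S (K + N) := by
    intro N
    rw [ENNReal.tsum_sigma']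
    refine ENNReal.tsum_le_tsum fun K => ?_
    rw [tsum_fintype]
    exact ht (K + N)
  have hle := Measure.hausdorffMeasure_le_liminf_tsum (β := ℕ) (ι := fun N => Σ K, ι (K + N)) d Y
    (l := atTop) (fun N => (∑' K, S (K + N)) ^ (1 / d)) ?_
    (fun N p => t (p.1 + N) p.2) ?_ ?_
  · refine le_antisymm (hle.trans ?_) zero_le
    refine (liminf_le_liminf (Eventually.of_forall hsum)).trans ?_
    rw [htail.liminf_eq]
  · have := ((ENNReal.continuous_rpow_const (y := 1 / d)).tendsto 0).comp htail
    rwa [ENNReal.zero_rpow_of_pos (by positivity)] at this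
  · refine Eventually.of_forall fun N p => ?_
    rw [one_div, ENNReal.le_rpow_inv_iff hd]
    exact (ENNReal.le_tsum p).trans (hsum N)
  · refine Eventually.of_forall fun N x hx => ?_
    obtain ⟨K, hK, i, hi⟩ := hY x hx N
    obtain ⟨K, rfl⟩ := Nat.exists_eq_add_of_le' hK
    exact mem_iUnion.2 ⟨⟨K, i⟩, hi⟩

/-- Weight attached to a pair of words. -/
def wgt {Γ₁ Γ₂ : Type*} [Fintype Γ₂] (θ : Γ₁ × Γ₂ → ℝ) (η : Γ₁ → ℝ) {L j : ℕ}
    (u : Fin L → Γ₁ × Γ₂) (v : Fin j → Γ₁) : ℝ :=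
  (∏ t, θ (u t) / colSum θ (u t).1 * η (u t).1) * ∏ t, η (v t)

theorem wgt_nonneg {Γ₁ Γ₂ : Type*} [Fintype Γ₂] (θ : Γ₁ × Γ₂ → ℝ) (η : Γ₁ → ℝ)
    (hθ : ∀ γ, 0 ≤ θ γ) (hη : ∀ i, 0 ≤ η i) {L j : ℕ}
    (u : Fin L → Γ₁ × Γ₂) (v : Fin j → Γ₁) : 0 ≤ wgt θ η u v := by
  refine mul_nonneg (Finset.prod_nonneg fun t _ => ?_) (Finset.prod_nonneg fun t _ => hη _)
  exact mul_nonneg (div_nonneg (hθ _) (Finset.sum_nonneg fun _ _ => hθ _)) (hη _)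

theorem sum_wgt_le {Γ₁ Γ₂ : Type*} [Fintype Γ₁] [Fintype Γ₂] (θ : Γ₁ × Γ₂ → ℝ) (η : Γ₁ → ℝ)
    (hθ : ∀ γ, 0 ≤ θ γ) (hη : ∀ i, 0 ≤ η i) (h1 : ∑ i, η i = 1) (L j : ℕ) :
    ∑ p : (Fin L → Γ₁ × Γ₂) × (Fin j → Γ₁), wgt θ η p.1 p.2 ≤ 1 := by
  classical
  rw [Fintype.sum_prod_type]
  simp only [wgt]
  simp_rw [← Finset.mul_sum]
  rw [← Finset.sum_mul, ← Fintype.sum_pow (fun γ : Γ₁ × Γ₂ => θ γ / colSum θ γ.1 * η γ.1),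
    ← Fintype.sum_pow η, h1, one_pow, mul_one]
  have h0 : ∀ γ : Γ₁ × Γ₂, 0 ≤ θ γ / colSum θ γ.1 * η γ.1 := fun γ =>
    mul_nonneg (div_nonneg (hθ _) (Finset.sum_nonneg fun _ _ => hθ _)) (hη _)
  refine pow_le_one₀ (Finset.sum_nonneg fun γ _ => h0 γ) ?_
  rw [Fintype.sum_prod_type, ← h1]
  refine Finset.sum_le_sum fun i _ => ?_
  simp only
  rw [← Finset.sum_mul, ← Finset.sum_div]
  refine mul_le_of_le_one_left (hη i) (div_self_le_one _)

open Classical in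
/-- Empirical frequency vector of the first `L` letters. -/
def emp {Γ : Type*} (ω : ℕ → Γ) (L : ℕ) (γ : Γ) : ℝ :=
  (((Finset.range L).filter fun t => ω t = γ).card : ℝ) / L

theorem emp_nonneg {Γ : Type*} (ω : ℕ → Γ) (L : ℕ) (γ : Γ) : 0 ≤ emp ω L γ := by
  unfold emp; positivity

theorem emp_pos {Γ : Type*} (ω : ℕ → Γ) {L t : ℕ} (ht : t < L) : 0 < emp ω L (ω t) := by
  classical
  unfold emp
  have : 0 < ((Finset.range L).filter fun s => ω s = ω t).card :=
    Finset.card_pos.2 ⟨t, by simp [ht]⟩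
  have hL : 0 < L := by omega
  have h1 : (0:ℝ) < ((Finset.range L).filter fun s => ω s = ω t).card := by exact_mod_cast this
  have h2 : (0:ℝ) < L := by exact_mod_cast hL
  convert div_pos h1 h2

theorem sum_emp_mul {Γ : Type*} [Fintype Γ] (ω : ℕ → Γ) (L : ℕ) (h : Γ → ℝ) :
    ∑ γ, emp ω L γ * h γ = (∑ t ∈ Finset.range L, h (ω t)) / L := by
  classical
  rw [← Finset.sum_fiberwise (Finset.range L) ω (fun t => h (ω t)), Finset.sum_div]
  refine Finset.sum_congr rfl fun γ _ => ?_
  rw [Finset.sum_congr rfl (g := fun _ => h γ) (by intro t ht; rw [(Finset.mem_filter.1 ht).2])]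
  rw [Finset.sum_const, nsmul_eq_mul, emp]
  have : ∀ (n : ℕ), (n:ℝ) / L * h γ = (n * h γ) / L := fun n => by ring
  convert this _

theorem sum_emp {Γ : Type*} [Fintype Γ] (ω : ℕ → Γ) (L : ℕ) (hL : 0 < L) :
    ∑ γ, emp ω L γ = 1 := by
  have := sum_emp_mul ω L (fun _ => 1)
  have h2 : (L:ℝ) ≠ 0 := by exact_mod_cast hL.ne'
  simpa [h2] using this

theorem colSum_emp {Γ₁ Γ₂ : Type*} [Fintype Γ₁] [Fintype Γ₂] (ω : ℕ → Γ₁ × Γ₂) (L : ℕ) (i : Γ₁) :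
    colSum (emp ω L) i = emp (fun t => (ω t).1) L i := by
  classical
  have h1 := sum_emp_mul ω L (fun γ => if γ.1 = i then 1 else 0)
  have h2 := sum_emp_mul (fun t => (ω t).1) L (fun k => if k = i then 1 else 0)
  rw [← h1] at h2
  rw [Fintype.sum_prod_type] at h2
  simp only [mul_ite, mul_one, mul_zero, Finset.sum_ite_eq', Finset.mem_univ, if_true] at h2
  rw [h2, colSum, Finset.sum_eq_single i]
  · simp
  · intro b _ hb; simp [hb]
  · simp

/-- Index type of the coverings at level `K`. -/
abbrev CovIdx (Γ₁ Γ₂ : Type) (K : ℕ) : Type :=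
  ((Γ₁ × Γ₂ → Fin (K + 1)) × (Γ₁ → Fin (K + 1))) ×
    (Σ Lj : Fin (K + 1) × Fin (K + 1), (Fin Lj.1 → Γ₁ × Γ₂) × (Fin Lj.2 → Γ₁))

theorem summable_poly_exp (m : ℕ) (c e : ℝ) (he : 0 < e) :
    Summable fun K : ℕ => ((K:ℝ) + 1) ^ m * Real.exp (c - e * K) := by
  have h := summable_pow_mul_geometric_of_norm_lt_one m (r := Real.exp (-e))
    (by rw [Real.norm_eq_abs, abs_of_pos (Real.exp_pos _)]; exact (Real.exp_lt_exp.2 (by linarith)).trans_eq Real.exp_zero)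
  have h2 := ((summable_nat_add_iff 1).2 h).mul_left (Real.exp (c + e))
  refine h2.congr fun K => ?_
  rw [← Real.exp_nat_mul]
  push_cast
  rw [mul_left_comm, ← Real.exp_add]
  congr 2
  ring

/-- Minus the log-likelihood of the first coordinates under their own empirical measure. -/
def xent {Γ₁ Γ₂ : Type*} [Fintype Γ₂] (ω : ℕ → Γ₁ × Γ₂) (K : ℕ) : ℝ :=
  -∑ t ∈ Finset.range K, Real.log (colSum (emp ω K) (ω t).1)

/-- Minus the log-likelihood of the pairs under their own empirical measure. -/
def eent {Γ₁ Γ₂ : Type*} (ω : ℕ → Γ₁ × Γ₂) (K : ℕ) : ℝ :=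
  -∑ t ∈ Finset.range K, Real.log (emp ω K (ω t))

theorem wgt_emp {Γ₁ Γ₂ : Type*} [Fintype Γ₁] [Fintype Γ₂] (ω : ℕ → Γ₁ × Γ₂) (L j : ℕ) :
    wgt (emp ω L) (colSum (emp ω (L + j))) (fun t : Fin L => ω t)
      (fun t : Fin j => (ω (L + t)).1) =
    Real.exp (-(eent ω L - xent ω L + xent ω (L + j))) := by
  have hc : ∀ K t, t < K → 0 < colSum (emp ω K) (ω t).1 := by
    intro K t ht
    rw [colSum_emp]
    exact emp_pos (fun t => (ω t).1) ht
  have e1 : ∀ t : Fin L, emp ω L (ω t) / colSum (emp ω L) (ω t).1 *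
      colSum (emp ω (L + j)) (ω t).1 = Real.exp (Real.log (emp ω L (ω t)) -
        Real.log (colSum (emp ω L) (ω t).1) + Real.log (colSum (emp ω (L + j)) (ω t).1)) := by
    intro t
    rw [Real.exp_add, Real.exp_sub, Real.exp_log (emp_pos ω t.2), Real.exp_log (hc _ _ t.2),
      Real.exp_log (hc _ _ (by omega))]
  have e2 : ∀ t : Fin j, colSum (emp ω (L + j)) (ω (L + t)).1 =
      Real.exp (Real.log (colSum (emp ω (L + j)) (ω (L + t)).1)) := by
    intro t
    rw [Real.exp_log (hc _ _ (by omega))]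
  rw [wgt, Finset.prod_congr rfl (fun t _ => e1 t), Finset.prod_congr rfl (fun t _ => e2 t),
    ← Real.exp_sum, ← Real.exp_sum, ← Real.exp_add]
  congr 1
  have hx : xent ω (L + j) = -(∑ t ∈ Finset.range L, Real.log (colSum (emp ω (L + j)) (ω t).1) +
      ∑ t ∈ Finset.range j, Real.log (colSum (emp ω (L + j)) (ω (L + t)).1)) := by
    rw [xent, Finset.sum_range_add]
  rw [hx]
  simp only [eent, xent, Finset.sum_add_distrib, Finset.sum_sub_distrib, Finset.sum_range]
  ring

theorem dimH_limsup_le {Γ₁ Γ₂ : Type} [Fintype Γ₁] [Fintype Γ₂]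
    (φ : Γ₁ → ℝ → ℝ) (ψ : Γ₂ → ℝ → ℝ) (α : Γ₁ → ℝ) (β : Γ₂ → ℝ)
    (hφ : ∀ i, MapsTo (φ i) (Icc (0:ℝ) 1) (Icc (0:ℝ) 1))
    (hψ : ∀ i, MapsTo (ψ i) (Icc (0:ℝ) 1) (Icc (0:ℝ) 1))
    (hφl : ∀ i, ∀ x ∈ Icc (0:ℝ) 1, ∀ y ∈ Icc (0:ℝ) 1,
      |φ i x - φ i y| ≤ Real.exp (-α i) * |x - y|)
    (hψl : ∀ i, ∀ x ∈ Icc (0:ℝ) 1, ∀ y ∈ Icc (0:ℝ) 1,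
      |ψ i x - ψ i y| ≤ Real.exp (-β i) * |x - y|)
    (s ε a₀ c₀ : ℝ) (hs : 0 ≤ s) (hε : 0 < ε) (ha₀ : 0 < a₀) (Y : Set (ℝ × ℝ))
    (hY : ∀ z ∈ Y, ∃ ω : ℕ → Γ₁ × Γ₂,
      (∀ k, z.1 ∈ compWord φ (pre (fun t => (ω t).1) k) '' Icc 0 1) ∧
      (∀ k, z.2 ∈ compWord ψ (pre (fun t => (ω t).2) k) '' Icc 0 1) ∧
      ∀ N, ∃ K ≥ N, ∃ L ≤ K, ∃ D, D ≤ ∑ t ∈ Finset.range K, α (ω t).1 ∧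
        D ≤ ∑ t ∈ Finset.range L, β (ω t).2 ∧ a₀ * K - c₀ ≤ D ∧
        eent ω L - xent ω L + xent ω K ≤ s * D) :
    dimH Y ≤ ENNReal.ofReal (s + ε) := by
  classical
  let θ : ∀ K, CovIdx Γ₁ Γ₂ K → Γ₁ × Γ₂ → ℝ := fun K q γ => (q.1.1 γ : ℕ) / ((q.2.1.1 : ℕ) : ℝ)
  let η : ∀ K, CovIdx Γ₁ Γ₂ K → Γ₁ → ℝ := fun K q γ => (q.1.2 γ : ℕ) / (K : ℝ)
  let Sel : ∀ K, CovIdx Γ₁ Γ₂ K → Prop := fun K q => ∑ i, η K q i = 1 ∧ ∃ D, a₀ * K - c₀ ≤ D ∧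
    D ≤ ((List.ofFn (fun t => (q.2.2.1 t).1) ++ List.ofFn q.2.2.2).map α).sum ∧
    D ≤ ((List.ofFn (fun t => (q.2.2.1 t).2)).map β).sum ∧
    Real.exp (-(s * D)) ≤ wgt (θ K q) (η K q) q.2.2.1 q.2.2.2
  let T : ∀ K, CovIdx Γ₁ Γ₂ K → Set (ℝ × ℝ) := fun K q => {z | Sel K q ∧
    z.1 ∈ compWord φ (List.ofFn (fun t => (q.2.2.1 t).1) ++ List.ofFn q.2.2.2) '' Icc 0 1 ∧
    z.2 ∈ compWord ψ (List.ofFn (fun t => (q.2.2.1 t).2)) '' Icc 0 1}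
  let W : ∀ K, CovIdx Γ₁ Γ₂ K → ℝ := fun K q =>
    if ∑ i, η K q i = 1 then wgt (θ K q) (η K q) q.2.2.1 q.2.2.2 else 0
  have hθ0 : ∀ K q γ, 0 ≤ θ K q γ := fun K q γ => by simp only [θ]; positivity
  have hη0 : ∀ K q γ, 0 ≤ η K q γ := fun K q γ => by simp only [η]; positivity
  have hW0 : ∀ K q, 0 ≤ W K q := by
    intro K q
    simp only [W]
    split_ifs
    · exact wgt_nonneg _ _ (hθ0 K q) (hη0 K q) _ _
    · exact le_rfl
  set G := Fintype.card (Γ₁ × Γ₂)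
  set G₁ := Fintype.card Γ₁
  have hWsum : ∀ K, ∑ q, W K q ≤ ((K:ℝ) + 1) ^ (G + G₁ + 2) := by
    intro K
    rw [Fintype.sum_prod_type]
    have : ∀ cd : (Γ₁ × Γ₂ → Fin (K + 1)) × (Γ₁ → Fin (K + 1)),
        ∑ r, W K (cd, r) ≤ ((K:ℝ) + 1) ^ 2 := by
      intro cd
      rw [Fintype.sum_sigma]
      have h1 : ∀ Lj : Fin (K + 1) × Fin (K + 1),
          ∑ uv : (Fin Lj.1 → Γ₁ × Γ₂) × (Fin Lj.2 → Γ₁), W K (cd, ⟨Lj, uv⟩) ≤ 1 := by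
        intro Lj
        by_cases h : ∑ i, ((cd.2 i : ℕ) : ℝ) / (K : ℝ) = 1
        · have := sum_wgt_le (fun γ => ((cd.1 γ : ℕ) : ℝ) / ((Lj.1 : ℕ) : ℝ))
            (fun i => ((cd.2 i : ℕ) : ℝ) / (K : ℝ)) (fun _ => by positivity)
            (fun _ => by positivity) h Lj.1 Lj.2
          simpa only [W, η, θ, h, if_true] using this
        · simp only [W, η, h, if_false, Finset.sum_const_zero]
          exact zero_le_one
      refine (Finset.sum_le_sum fun Lj _ => h1 Lj).trans ?_
      simp [pow_two]
    refine (Finset.sum_le_sum fun cd _ => this cd).trans ?_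
    rw [Finset.sum_const, nsmul_eq_mul, Finset.card_univ]
    simp only [Fintype.card_prod, Fintype.card_fun, Fintype.card_fin]
    push_cast
    refine le_of_eq ?_
    simp only [G, G₁, Fintype.card_prod]
    ring
  let S : ℕ → ℝ≥0∞ := fun K =>
    ENNReal.ofReal (((K:ℝ) + 1) ^ (G + G₁ + 2) * Real.exp (ε * c₀ - (ε * a₀) * K))
  have hS : ∑' K, S K ≠ ⊤ := (summable_poly_exp _ _ _ (by positivity)).tsum_ofReal_ne_top
  have hd : 0 < s + ε := by linarith
  have hdiam : ∀ K q, ediam (T K q) ^ (s + ε) ≤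
      ENNReal.ofReal (W K q * Real.exp (ε * c₀ - (ε * a₀) * K)) := by
    intro K q
    by_cases hq : Sel K q
    · obtain ⟨h1, D, hD0, hD1, hD2, hD3⟩ := hq
      have hdi : ediam (T K q) ≤ ENNReal.ofReal (Real.exp (-D)) := by
        refine Metric.ediam_le ?_
        rintro z ⟨_, ⟨x, hx, hxz⟩, ⟨y, hy, hyz⟩⟩ z' ⟨_, ⟨x', hx', hxz'⟩, ⟨y', hy', hyz'⟩⟩
        rw [edist_dist]
        refine ENNReal.ofReal_le_ofReal ?_
        rw [Prod.dist_eq, ← hxz, ← hyz, ← hxz', ← hyz', Real.dist_eq, Real.dist_eq]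
        refine max_le ?_ ?_
        · refine (compWord_lip_exp φ α hφ hφl _ x hx x' hx').trans ?_
          refine (mul_le_of_le_one_right (Real.exp_pos _).le (abs_sub_le_one hx hx')).trans ?_
          exact Real.exp_le_exp.2 (by linarith)
        · refine (compWord_lip_exp ψ β hψ hψl _ y hy y' hy').trans ?_
          refine (mul_le_of_le_one_right (Real.exp_pos _).le (abs_sub_le_one hy hy')).trans ?_
          exact Real.exp_le_exp.2 (by linarith)
      refine (ENNReal.rpow_le_rpow hdi hd.le).trans ?_
      rw [ENNReal.ofReal_rpow_of_pos (Real.exp_pos _)]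
      refine ENNReal.ofReal_le_ofReal ?_
      have hWq : W K q = wgt (θ K q) (η K q) q.2.2.1 q.2.2.2 := if_pos h1
      rw [hWq, ← Real.exp_mul]
      calc Real.exp (-D * (s + ε)) = Real.exp (-(s * D)) * Real.exp (-(ε * D)) := by
            rw [← Real.exp_add]; ring_nf
        _ ≤ _ := by
            refine mul_le_mul hD3 (Real.exp_le_exp.2 ?_) (Real.exp_pos _).le
              ((Real.exp_pos _).le.trans hD3)
            nlinarith
    · have : T K q = ∅ := by
        ext z; simp [T, hq]
      rw [this, Metric.ediam_empty, ENNReal.zero_rpow_of_pos hd]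
      exact zero_le
  have hH := hausdorff_limsup_zero (ι := CovIdx Γ₁ Γ₂) (s + ε) hd T S hS ?_ Y ?_
  · have := dimH_le_of_hausdorffMeasure_ne_top (s := Y) (d := (s + ε).toNNReal)
      (by rw [Real.coe_toNNReal _ hd.le, hH]; exact ENNReal.zero_ne_top)
    exact this
  · intro K
    refine (Finset.sum_le_sum fun q _ => hdiam K q).trans ?_
    rw [← ENNReal.ofReal_sum_of_nonneg (fun q _ => mul_nonneg (hW0 K q) (Real.exp_pos _).le),
      ← Finset.sum_mul]
    exact ENNReal.ofReal_le_ofReal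
      (mul_le_mul_of_nonneg_right (hWsum K) (Real.exp_pos _).le)
  · intro z hz N
    obtain ⟨ω, h1, h2, h3⟩ := hY z hz
    obtain ⟨K, hK, L, hL, D, hD1, hD2, hD0, hD3⟩ := h3 (max N 1)
    have hK1 : 0 < K := le_trans (le_max_right N 1) hK
    refine ⟨K, (le_max_left _ _).trans hK, ?_⟩
    obtain ⟨j, hj⟩ := Nat.exists_eq_add_of_le hL
    let q : CovIdx Γ₁ Γ₂ K := ⟨⟨fun γ => ⟨((Finset.range L).filter fun t => ω t = γ).card, by
        have := Finset.card_filter_le (Finset.range L) (fun t => ω t = γ)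
        rw [Finset.card_range] at this; omega⟩,
      fun i => ⟨((Finset.range K).filter fun t => (ω t).1 = i).card, by
        have := Finset.card_filter_le (Finset.range K) (fun t => (ω t).1 = i)
        rw [Finset.card_range] at this; omega⟩⟩,
      ⟨⟨⟨L, by omega⟩, ⟨j, by omega⟩⟩, fun t => ω t, fun t => (ω (L + t)).1⟩⟩
    have hθq : θ K q = emp ω L := by
      funext γ; simp only [θ, q, emp]; congr!
    have hηq : η K q = colSum (emp ω K) := by
      funext i; rw [colSum_emp]; simp only [η, q, emp]
    have hpre : List.ofFn (fun t => (q.2.2.1 t).1) ++ List.ofFn q.2.2.2 =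
        pre (fun t => (ω t).1) K := by
      have h5 : pre (fun t => (ω t).1) K = pre (fun t => (ω t).1) (L + j) := by rw [← hj]
      exact (h5.trans (pre_add _ _ _)).symm
    have hpre2 : List.ofFn (fun t => (q.2.2.1 t).2) = pre (fun t => (ω t).2) L := rfl
    refine ⟨q, ⟨?_, D, hD0, ?_, ?_, ?_⟩, ?_, ?_⟩
    · rw [hηq]
      simp_rw [colSum_emp]
      exact sum_emp _ K hK1
    · rw [hpre, pre_map_sum]; exact hD1
    · rw [hpre2, pre_map_sum]; exact hD2
    · rw [hθq, hηq]
      have := wgt_emp ω L j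
      rw [← hj] at this
      have h5 : wgt (emp ω L) (colSum (emp ω K)) q.2.2.1 q.2.2.2 = _ := this
      rw [h5]
      exact Real.exp_le_exp.2 (by linarith)
    · rw [hpre]; exact h1 K
    · rw [hpre2]; exact h2 L

/-! ### Upper bound: selection of good scales -/

/-- The property infinitely many good levels. -/
def GoodLevels (α β e x : ℕ → ℝ) (a₀ a₁ s : ℝ) : Prop :=
  ∀ N : ℕ, ∃ K ≥ N, ∃ L ≤ K, ∃ D, D ≤ α K ∧ D ≤ β L ∧ a₀ * K - a₁ ≤ D ∧
    e L - x L + x K ≤ s * D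

theorem le_of_step (α : ℕ → ℝ) (a₀ : ℝ) (h0 : α 0 = 0) (h1 : ∀ L, a₀ ≤ α (L + 1) - α L) (L : ℕ) :
    a₀ * L ≤ α L := by
  induction L with
  | zero => simp [h0]
  | succ L ih => have := h1 L; push_cast; linarith

theorem goodLevels_of_le (α β e x : ℕ → ℝ) (a₀ a₁ B M ε : ℝ) (ha₀ : 0 < a₀)
    (hα0 : α 0 = 0) (hβ0 : β 0 = 0) (hα : ∀ L, a₀ ≤ α (L + 1) - α L)
    (hα' : ∀ L, α (L + 1) - α L ≤ a₁) (hβ : ∀ L, a₀ ≤ β (L + 1) - β L)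
    (hx0 : ∀ L, 0 ≤ x L) (hB : ∀ L, x L ≤ B * α L) (hε : 0 < ε) (N₀ : ℕ)
    (hle : ∀ L ≥ N₀, α L ≤ β L)
    (hg : ∀ L ≥ 1, L ≥ N₀ → α L ≤ β L → x L / α L + (e L - x L) / β L ≤ M) :
    GoodLevels α β e x a₀ a₁ (M + ε) := by
  by_contra hcon
  simp only [GoodLevels, not_forall, not_exists, not_and] at hcon
  obtain ⟨N, hN⟩ := hcon
  have hαlow := le_of_step α a₀ hα0 hα
  have hβlow := le_of_step β a₀ hβ0 hβ
  have ha₁ : 0 < a₁ := ha₀.trans_le ((hα 0).trans (hα' 0))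
  have hαpos : ∀ L ≥ 1, 0 < α L := fun L hL => lt_of_lt_of_le (by
    have : (0:ℝ) < L := by exact_mod_cast hL
    positivity) (hαlow L)
  have hB0 : 0 ≤ B := by
    have h1 := hB 1
    have h2 := hαpos 1 le_rfl
    have h3 := hx0 1
    by_contra h
    push Not at h
    nlinarith
  obtain ⟨n₁, hn₁⟩ := exists_nat_gt (2 * B * a₁ / ε / a₀)
  set N₁ := max (max N N₀) (max 1 n₁) with hN₁
  have step : ∀ L ≥ N₁, ∃ K ≥ N₁, x L / α L + ε / 2 ≤ x K / α K := by
    intro L hL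
    have hLN : N ≤ L := le_trans (by simp [N₁]) hL
    have hLN₀ : N₀ ≤ L := le_trans (by simp [N₁]) hL
    have hL1 : 1 ≤ L := le_trans (by simp [N₁]) hL
    have hLn : n₁ ≤ L := le_trans (by simp [N₁]) hL
    have hLpos : (0:ℝ) < L := by exact_mod_cast hL1
    have hβpos : 0 < β L := lt_of_lt_of_le (by positivity) (hβlow L)
    have hex : ∃ K, L ≤ K ∧ β L ≤ α K := by
      obtain ⟨m, hm⟩ := exists_nat_gt (β L / a₀)
      refine ⟨max L m, le_max_left _ _, ?_⟩
      refine le_trans ?_ (hαlow _)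
      rw [div_lt_iff₀ ha₀] at hm
      have : (m:ℝ) ≤ (max L m : ℕ) := by exact_mod_cast le_max_right L m
      nlinarith
    classical
    obtain ⟨K, ⟨hKL, hKα⟩, hmin⟩ : ∃ K, (L ≤ K ∧ β L ≤ α K) ∧ ∀ K' < K, ¬ (L ≤ K' ∧ β L ≤ α K') :=
      ⟨Nat.find hex, Nat.find_spec hex, fun K' h => Nat.find_min hex h⟩
    have hKup : α K ≤ β L + a₁ := by
      rcases eq_or_lt_of_le hKL with h | h
      · rw [← h]; linarith [hle L hLN₀]
      · obtain ⟨K', rfl⟩ : ∃ K', K = K' + 1 := ⟨K - 1, by omega⟩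
        have h2 := hmin K' (by omega)
        have h3 : α K' < β L := by
          by_contra h4
          exact h2 ⟨by omega, not_lt.1 h4⟩
        linarith [hα' K']
    refine ⟨K, hL.trans hKL, ?_⟩
    have h1 := hN K (hLN.trans hKL) L hKL (β L) hKα le_rfl (by linarith [hαlow K])
    push Not at h1
    have hgL := hg L hL1 hLN₀ (hle L hLN₀)
    have hKpos := hαpos K (hL1.trans hKL)
    set FL := x L / α L
    have hFK : x K = x K / α K * α K := by field_simp
    have hFKB : x K / α K ≤ B := by rw [div_le_iff₀ hKpos]; exact hB K
    have hFK0 : 0 ≤ x K / α K := div_nonneg (hx0 K) hKpos.le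
    set FK := x K / α K
    have h2 : e L - x L ≤ (M - FL) * β L := by
      rw [← div_le_iff₀ hβpos]; linarith
    have h3 : x K ≤ FK * (β L + a₁) := by
      rw [hFK]; exact mul_le_mul_of_nonneg_left hKup hFK0
    have h4 : B * a₁ ≤ ε / 2 * β L := by
      have h5 : 2 * B * a₁ / ε / a₀ ≤ L := hn₁.le.trans (by exact_mod_cast hLn)
      rw [div_le_iff₀ ha₀, div_le_iff₀ hε] at h5
      have := hβlow L
      nlinarith
    have h6 : FK * a₁ ≤ B * a₁ := mul_le_mul_of_nonneg_right hFKB ha₁.le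
    by_contra h7
    push Not at h7
    nlinarith
  have iter : ∀ m : ℕ, ∃ L ≥ N₁, m * (ε / 2) ≤ x L / α L := by
    intro m
    induction m with
    | zero =>
      refine ⟨N₁, le_rfl, ?_⟩
      have : 0 < α N₁ := hαpos _ (by simp [N₁])
      simpa using div_nonneg (hx0 _) this.le
    | succ m ih =>
      obtain ⟨L, hL, h⟩ := ih
      obtain ⟨K, hK, h'⟩ := step L hL
      refine ⟨K, hK, ?_⟩
      push_cast
      linarith
  obtain ⟨m, hm⟩ := exists_nat_gt (B / (ε / 2))
  obtain ⟨L, hL, h⟩ := iter m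
  have h1 : 0 < α L := hαpos _ (le_trans (by simp [N₁]) hL)
  have h2 : x L / α L ≤ B := by rw [div_le_iff₀ h1]; exact hB L
  rw [div_lt_iff₀ (by positivity)] at hm
  linarith

theorem goodLevels_of_crossing (α β e x : ℕ → ℝ) (a₀ a₁ M ε : ℝ) (ha₀ : 0 < a₀)
    (hα0 : α 0 = 0) (hα : ∀ L, a₀ ≤ α (L + 1) - α L)
    (hα' : ∀ L, α (L + 1) - α L ≤ a₁) (hβ : ∀ L, a₀ ≤ β (L + 1) - β L)
    (hx0 : ∀ L, 0 ≤ x L) (hM : 0 ≤ M) (hε : 0 < ε)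
    (hcr : ∀ N, ∃ L ≥ N, α L ≤ β L ∧ β (L + 1) < α (L + 1))
    (hg : ∀ L ≥ 1, α L ≤ β L → x L / α L + (e L - x L) / β L ≤ M) :
    GoodLevels α β e x a₀ a₁ (M + ε) := by
  intro N
  have hαlow := le_of_step α a₀ hα0 hα
  have ha₁ : 0 < a₁ := ha₀.trans_le ((hα 0).trans (hα' 0))
  obtain ⟨n₁, hn₁⟩ := exists_nat_gt (M * a₁ / ε / a₀)
  obtain ⟨L, hL, h1, h2⟩ := hcr (max (max N 1) n₁)
  have hLN : N ≤ L := le_trans (by simp) hL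
  have hL1 : 1 ≤ L := le_trans (by simp) hL
  have hLn : n₁ ≤ L := le_trans (by simp) hL
  have hLpos : (0:ℝ) < L := by exact_mod_cast hL1
  have hαpos : 0 < α L := lt_of_lt_of_le (by positivity) (hαlow L)
  have hβpos : 0 < β L := hαpos.trans_le h1
  refine ⟨L, hLN, L, le_rfl, α L, le_rfl, h1, by linarith [hαlow L], ?_⟩
  have hgL := hg L hL1 h1
  have h3 : x L / β L ≤ x L / α L := div_le_div_of_nonneg_left (hx0 L) hαpos h1
  have h4 : e L / β L ≤ M := by
    have : e L / β L = x L / β L + (e L - x L) / β L := by ring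
    linarith
  rw [div_le_iff₀ hβpos] at h4
  have h5 : β L ≤ α L + a₁ := by linarith [hα' L, hβ L]
  have h6 : M * a₁ ≤ ε * α L := by
    have h5 : M * a₁ / ε / a₀ ≤ L := hn₁.le.trans (by exact_mod_cast hLn)
    rw [div_le_iff₀ ha₀, div_le_iff₀ hε] at h5
    have := hαlow L
    nlinarith
  nlinarith

theorem goodLevels_or (α β e x y : ℕ → ℝ) (a₀ a₁ B M ε : ℝ) (ha₀ : 0 < a₀)
    (hα0 : α 0 = 0) (hβ0 : β 0 = 0) (hα : ∀ L, a₀ ≤ α (L + 1) - α L)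
    (hα' : ∀ L, α (L + 1) - α L ≤ a₁) (hβ : ∀ L, a₀ ≤ β (L + 1) - β L)
    (hβ' : ∀ L, β (L + 1) - β L ≤ a₁)
    (hx0 : ∀ L, 0 ≤ x L) (hB : ∀ L, x L ≤ B * α L)
    (hy0 : ∀ L, 0 ≤ y L) (hBy : ∀ L, y L ≤ B * β L) (hM : 0 ≤ M) (hε : 0 < ε)
    (hg : ∀ L ≥ 1, α L ≤ β L → x L / α L + (e L - x L) / β L ≤ M)
    (hg' : ∀ L ≥ 1, β L < α L → y L / β L + (e L - y L) / α L ≤ M) :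
    GoodLevels α β e x a₀ a₁ (M + ε) ∨ GoodLevels β α e y a₀ a₁ (M + ε) := by
  by_cases h1 : ∃ N₀, ∀ L ≥ N₀, α L ≤ β L
  · obtain ⟨N₀, h⟩ := h1
    exact Or.inl (goodLevels_of_le α β e x a₀ a₁ B M ε ha₀ hα0 hβ0 hα hα' hβ hx0 hB hε N₀ h
      (fun L h1 _ => hg L h1))
  by_cases h2 : ∃ N₀, ∀ L ≥ N₀, β L < α L
  · obtain ⟨N₀, h⟩ := h2
    exact Or.inr (goodLevels_of_le β α e y a₀ a₁ B M ε ha₀ hβ0 hα0 hβ hβ' hα hy0 hBy hε N₀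
      (fun L hL => (h L hL).le) (fun L h1 h2 _ => hg' L h1 (h L h2)))
  push Not at h1 h2
  refine Or.inl (goodLevels_of_crossing α β e x a₀ a₁ M ε ha₀ hα0 hα hα' hβ hx0 hM hε ?_ hg)
  intro N
  obtain ⟨L₁, hL₁, h3⟩ := h2 N
  obtain ⟨L₂, hL₂, h4⟩ := h1 L₁
  by_contra hcon
  push Not at hcon
  have : ∀ m, α (L₁ + m) ≤ β (L₁ + m) := by
    intro m
    induction m with
    | zero => exact h3
    | succ m ih => exact hcon (L₁ + m) (by omega) ih
  have h5 := this (L₂ - L₁)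
  rw [Nat.add_sub_cancel' hL₂] at h5
  linarith

/-! ### Upper bound -/

theorem sum_prod_swap {Γ₁ Γ₂ : Type*} [Fintype Γ₁] [Fintype Γ₂] (h : Γ₁ × Γ₂ → ℝ) :
    ∑ z : Γ₂ × Γ₁, h z.swap = ∑ z : Γ₁ × Γ₂, h z :=
  Fintype.sum_equiv (Equiv.prodComm Γ₂ Γ₁) _ _ (fun _ => rfl)

theorem lyap1_swap {Γ₁ Γ₂ : Type*} [Fintype Γ₁] [Fintype Γ₂] (p : Γ₁ × Γ₂ → ℝ) (b : Γ₂ → ℝ) :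
    lyap1 (fun z : Γ₂ × Γ₁ => p z.swap) b = lyap2 p b :=
  sum_prod_swap (fun z => p z * Real.log (b z.2))

theorem lyap2_swap {Γ₁ Γ₂ : Type*} [Fintype Γ₁] [Fintype Γ₂] (p : Γ₁ × Γ₂ → ℝ) (a : Γ₁ → ℝ) :
    lyap2 (fun z : Γ₂ × Γ₁ => p z.swap) a = lyap1 p a :=
  sum_prod_swap (fun z => p z * Real.log (a z.1))

theorem gOne_swap {Γ₁ Γ₂ : Type*} [Fintype Γ₁] [Fintype Γ₂] (p : Γ₁ × Γ₂ → ℝ) (a : Γ₁ → ℝ)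
    (b : Γ₂ → ℝ) : gOne (fun z : Γ₂ × Γ₁ => p z.swap) b a = gTwo p a b := by
  unfold gOne gTwo
  rw [lyap1_swap, lyap2_swap]
  have h1 := sum_prod_swap (fun z => p z * Real.log (rowSum p z.2))
  have h2 := sum_prod_swap (fun z => p z * Real.log (p z))
  rw [← h1, ← h2]
  rfl

theorem emp_swap {Γ₁ Γ₂ : Type*} (ω : ℕ → Γ₁ × Γ₂) (L : ℕ) (z : Γ₂ × Γ₁) :
    emp (fun t => (ω t).swap) L z = emp ω L z.swap := by
  classical
  unfold emp
  congr 3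
  ext t
  simp [Prod.swap_eq_iff_eq_swap]

theorem eent_swap {Γ₁ Γ₂ : Type*} (ω : ℕ → Γ₁ × Γ₂) (L : ℕ) :
    eent (fun t => (ω t).swap) L = eent ω L := by
  unfold eent
  simp [emp_swap]

theorem gOne_emp {Γ₁ Γ₂ : Type*} [Fintype Γ₁] [Fintype Γ₂] (ω : ℕ → Γ₁ × Γ₂) (a : Γ₁ → ℝ)
    (b : Γ₂ → ℝ) (L : ℕ) (hL : 1 ≤ L) :
    gOne (emp ω L) a b = xent ω L / (∑ t ∈ Finset.range L, -Real.log (a (ω t).1)) +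
      (eent ω L - xent ω L) / (∑ t ∈ Finset.range L, -Real.log (b (ω t).2)) := by
  have hL0 : (L:ℝ) ≠ 0 := by positivity
  unfold gOne lyap1 lyap2 xent eent
  rw [sum_emp_mul ω L (fun ij => Real.log (colSum (emp ω L) ij.1)),
    sum_emp_mul ω L (fun ij => Real.log (a ij.1)), sum_emp_mul ω L (fun ij => Real.log (b ij.2)),
    sum_emp_mul ω L (fun ij => Real.log (emp ω L ij))]
  rw [Finset.sum_neg_distrib, Finset.sum_neg_distrib, neg_div_neg_eq, ← sub_div,
    div_div_div_cancel_right₀ hL0, div_div_div_cancel_right₀ hL0, ← neg_div_neg_eq (_ - _)]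
  congr 2
  ring

theorem xent_nonneg {Γ₁ Γ₂ : Type*} [Fintype Γ₁] [Fintype Γ₂] (ω : ℕ → Γ₁ × Γ₂) (L : ℕ) :
    0 ≤ xent ω L := by
  unfold xent
  rw [neg_nonneg]
  refine Finset.sum_nonpos fun t ht => ?_
  have htL : t < L := Finset.mem_range.1 ht
  rw [colSum_emp]
  refine Real.log_nonpos (emp_nonneg _ _ _) ?_
  rw [← sum_emp (fun t => (ω t).1) L (by omega)]
  exact Finset.single_le_sum (fun i _ => emp_nonneg _ _ i) (Finset.mem_univ _)

theorem xent_le {Γ₁ Γ₂ : Type*} [Fintype Γ₁] [Fintype Γ₂] (ω : ℕ → Γ₁ × Γ₂) (L : ℕ) :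
    xent ω L ≤ L * Fintype.card Γ₁ := by
  rcases Nat.eq_zero_or_pos L with rfl | hL
  · simp [xent]
  have hL0 : (0:ℝ) < L := by exact_mod_cast hL
  unfold xent
  rw [← Finset.sum_neg_distrib]
  calc ∑ t ∈ Finset.range L, -Real.log (colSum (emp ω L) (ω t).1)
      ≤ ∑ t ∈ Finset.range L, (emp (fun t => (ω t).1) L (ω t).1)⁻¹ := by
        refine Finset.sum_le_sum fun t ht => ?_
        have htL : t < L := Finset.mem_range.1 ht
        rw [colSum_emp]
        have := Real.one_sub_inv_le_log_of_pos (emp_pos (fun t => (ω t).1) htL)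
        linarith
    _ = L * ∑ i, emp (fun t => (ω t).1) L i * (emp (fun t => (ω t).1) L i)⁻¹ := by
        rw [sum_emp_mul (fun t => (ω t).1) L (fun i => (emp (fun t => (ω t).1) L i)⁻¹)]
        field_simp
    _ ≤ L * ∑ i : Γ₁, (1:ℝ) := by
        gcongr with i
        exact mul_inv_le_one
    _ = _ := by simp

theorem emp_probVec {Γ₁ Γ₂ : Type*} [Fintype Γ₁] [Fintype Γ₂] (A : Set (Γ₁ × Γ₂))
    (ω : ℕ → Γ₁ × Γ₂) (h : ∀ t, ω t ∈ A) (L : ℕ) (hL : 1 ≤ L) : IsProbVec A (emp ω L) := by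
  refine ⟨emp_nonneg ω L, ?_, sum_emp ω L hL⟩
  intro ij hij
  unfold emp
  rw [div_eq_zero_iff]
  left
  rw [Nat.cast_eq_zero, Finset.card_eq_zero, Finset.eq_empty_iff_forall_notMem]
  intro t ht
  have ht2 : ω t = ij := by
    simp only [Finset.mem_filter] at ht
    exact ht.2
  exact hij (ht2 ▸ h t)

theorem exists_coding {Γ₁ Γ₂ : Type*} (φ : Γ₁ → ℝ → ℝ) (ψ : Γ₂ → ℝ → ℝ) (A : Set (Γ₁ × Γ₂))
    (X : Set (ℝ × ℝ)) (hX : ∀ z ∈ X, ∃ γ ∈ A, ∃ z' ∈ X, z = (φ γ.1 z'.1, ψ γ.2 z'.2))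
    (z : ℝ × ℝ) (hz : z ∈ X) : ∃ ω : ℕ → Γ₁ × Γ₂, (∀ t, ω t ∈ A) ∧ ∀ k, ∃ z' ∈ X,
      z.1 = compWord φ (pre (fun t => (ω t).1) k) z'.1 ∧
      z.2 = compWord ψ (pre (fun t => (ω t).2) k) z'.2 := by
  have hne : Nonempty (Γ₁ × Γ₂) := ⟨(hX z hz).choose⟩
  choose! γ hγ nx hnx hz' using hX
  let orb : ℕ → ℝ × ℝ := fun k => nx^[k] z
  have horb : ∀ k, orb k ∈ X := by
    intro k
    induction k with
    | zero => exact hz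
    | succ k ih =>
      simp only [orb, Function.iterate_succ_apply']
      exact hnx _ ih
  refine ⟨fun k => γ (orb k), fun t => hγ _ (horb t), fun k => ⟨orb k, horb k, ?_⟩⟩
  induction k with
  | zero => simp [pre, compWord, orb]
  | succ k ih =>
    have h := hz' _ (horb k)
    have h1 : nx (orb k) = orb (k + 1) := by simp only [orb, Function.iterate_succ_apply']
    rw [h1] at h
    rw [pre_succ, pre_succ, compWord_append, compWord_append]
    have e1 : (orb k).1 = φ (γ (orb k)).1 (orb (k+1)).1 := congrArg Prod.fst h
    have e2 : (orb k).2 = ψ (γ (orb k)).2 (orb (k+1)).2 := congrArg Prod.snd h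
    refine ⟨?_, ?_⟩
    · rw [ih.1, e1]; rfl
    · rw [ih.2, e2]; rfl

theorem dimH_swap (Y : Set (ℝ × ℝ)) : dimH (Prod.swap '' Y) = dimH Y := by
  refine Isometry.dimH_image ?_ Y
  intro x y
  simp [Prod.edist_eq, max_comm]

theorem upper_bound {Γ₁ Γ₂ : Type} [Fintype Γ₁] [Fintype Γ₂]
    (φ : Γ₁ → ℝ → ℝ) (ψ : Γ₂ → ℝ → ℝ) (a : Γ₁ → ℝ) (b : Γ₂ → ℝ)
    (ha0 : ∀ i, 0 < a i) (ha1 : ∀ i, a i < 1) (hb0 : ∀ i, 0 < b i) (hb1 : ∀ i, b i < 1)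
    (hφ : ∀ i, MapsTo (φ i) (Icc (0:ℝ) 1) (Icc (0:ℝ) 1))
    (hψ : ∀ i, MapsTo (ψ i) (Icc (0:ℝ) 1) (Icc (0:ℝ) 1))
    (hφl : ∀ i, ∀ x ∈ Icc (0:ℝ) 1, ∀ y ∈ Icc (0:ℝ) 1, |φ i x - φ i y| ≤ a i * |x - y|)
    (hψl : ∀ i, ∀ x ∈ Icc (0:ℝ) 1, ∀ y ∈ Icc (0:ℝ) 1, |ψ i x - ψ i y| ≤ b i * |x - y|)
    (A : Set (Γ₁ × Γ₂)) (X : Set (ℝ × ℝ)) (hXI : X ⊆ Icc (0:ℝ) 1 ×ˢ Icc (0:ℝ) 1)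
    (hX : ∀ z ∈ X, ∃ γ ∈ A, ∃ z' ∈ X, z = (φ γ.1 z'.1, ψ γ.2 z'.2))
    (M : ℝ) (hM : 0 ≤ M) (hg : ∀ p, IsProbVec A p → gFun p a b ≤ M) :
    dimH X ≤ ENNReal.ofReal M := by
  -- uniform bounds for the logarithms
  set α : Γ₁ → ℝ := fun i => -Real.log (a i) with hα
  set β : Γ₂ → ℝ := fun i => -Real.log (b i) with hβ
  have hαp : ∀ i, 0 < α i := fun i => neg_pos.2 (Real.log_neg (ha0 i) (ha1 i))
  have hβp : ∀ i, 0 < β i := fun i => neg_pos.2 (Real.log_neg (hb0 i) (hb1 i))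
  obtain ⟨a₀, ha₀, ha₀α, ha₀β⟩ : ∃ a₀ : ℝ, 0 < a₀ ∧ (∀ i, a₀ ≤ α i) ∧ ∀ i, a₀ ≤ β i := by
    have key : ∀ (Γ : Type) [Fintype Γ] (u : Γ → ℝ), (∀ i, 0 < u i) →
        ∃ c : ℝ, 0 < c ∧ ∀ i, c ≤ u i := by
      intro Γ _ u hu
      cases isEmpty_or_nonempty Γ with
      | inl h => exact ⟨1, one_pos, fun i => h.elim i⟩
      | inr h =>
        obtain ⟨i₀, hi₀⟩ := Finite.exists_min u
        exact ⟨u i₀, hu i₀, hi₀⟩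
    obtain ⟨c, hc, hc'⟩ := key Γ₁ α hαp
    obtain ⟨d, hd, hd'⟩ := key Γ₂ β hβp
    exact ⟨min c d, lt_min hc hd, fun i => (min_le_left _ _).trans (hc' i),
      fun i => (min_le_right _ _).trans (hd' i)⟩
  obtain ⟨a₁, ha₁α, ha₁β⟩ : ∃ a₁ : ℝ, (∀ i, α i ≤ a₁) ∧ ∀ i, β i ≤ a₁ := by
    refine ⟨∑ i, α i + ∑ i, β i, fun i => ?_, fun i => ?_⟩
    · have := Finset.single_le_sum (fun i _ => (hαp i).le) (Finset.mem_univ i)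
      have h2 := Finset.sum_nonneg (s := Finset.univ) (fun i _ => (hβp i).le)
      linarith
    · have := Finset.single_le_sum (fun i _ => (hβp i).le) (Finset.mem_univ i)
      have h2 := Finset.sum_nonneg (s := Finset.univ) (fun i _ => (hαp i).le)
      linarith
  have hφe : ∀ i, ∀ x ∈ Icc (0:ℝ) 1, ∀ y ∈ Icc (0:ℝ) 1,
      |φ i x - φ i y| ≤ Real.exp (-α i) * |x - y| := by
    intro i x hx y hy
    simp only [hα, neg_neg, Real.exp_log (ha0 i)]
    exact hφl i x hx y hy
  have hψe : ∀ i, ∀ x ∈ Icc (0:ℝ) 1, ∀ y ∈ Icc (0:ℝ) 1,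
      |ψ i x - ψ i y| ≤ Real.exp (-β i) * |x - y| := by
    intro i x hx y hy
    simp only [hβ, neg_neg, Real.exp_log (hb0 i)]
    exact hψl i x hx y hy
  refine ENNReal.le_of_forall_pos_le_add ?_
  intro ε hε _
  have hε' : (0:ℝ) < ε := hε
  let S₁ : (ℕ → Γ₁ × Γ₂) → ℕ → ℝ := fun ω k => ∑ t ∈ Finset.range k, α (ω t).1
  let S₂ : (ℕ → Γ₁ × Γ₂) → ℕ → ℝ := fun ω k => ∑ t ∈ Finset.range k, β (ω t).2
  let Cod : ℝ × ℝ → (ℕ → Γ₁ × Γ₂) → Prop := fun z ω =>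
    (∀ k, z.1 ∈ compWord φ (pre (fun t => (ω t).1) k) '' Icc 0 1) ∧
      (∀ k, z.2 ∈ compWord ψ (pre (fun t => (ω t).2) k) '' Icc 0 1)
  let Y₁ : Set (ℝ × ℝ) := {z | ∃ ω, Cod z ω ∧
    GoodLevels (S₁ ω) (S₂ ω) (eent ω) (xent ω) a₀ a₁ (M + ε / 2)}
  let Y₂ : Set (ℝ × ℝ) := {z | ∃ ω, Cod z ω ∧
    GoodLevels (S₂ ω) (S₁ ω) (eent ω) (xent fun t => (ω t).swap) a₀ a₁ (M + ε / 2)}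
  have hsub : X ⊆ Y₁ ∪ Y₂ := by
    intro z hz
    obtain ⟨ω, hωA, hω⟩ := exists_coding φ ψ A X hX z hz
    have hcod : Cod z ω := by
      refine ⟨fun k => ?_, fun k => ?_⟩
      · obtain ⟨z', hz', h1, h2⟩ := hω k
        exact ⟨z'.1, (hXI hz').1, h1.symm⟩
      · obtain ⟨z', hz', h1, h2⟩ := hω k
        exact ⟨z'.2, (hXI hz').2, h2.symm⟩
    have hS₁ : ∀ L, S₁ ω (L + 1) - S₁ ω L = α (ω L).1 := by
      intro L; simp only [S₁, Finset.sum_range_succ]; ring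
    have hS₂ : ∀ L, S₂ ω (L + 1) - S₂ ω L = β (ω L).2 := by
      intro L; simp only [S₂, Finset.sum_range_succ]; ring
    have hα1 : ∀ L, a₀ ≤ S₁ ω (L + 1) - S₁ ω L := fun L => (ha₀α _).trans_eq (hS₁ L).symm
    have hβ1 : ∀ L, a₀ ≤ S₂ ω (L + 1) - S₂ ω L := fun L => (ha₀β _).trans_eq (hS₂ L).symm
    have h10 : S₁ ω 0 = 0 := by simp [S₁]
    have h20 : S₂ ω 0 = 0 := by simp [S₂]
    have hl1 := le_of_step _ _ h10 hα1
    have hl2 := le_of_step _ _ h20 hβ1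
    have hS₁L : ∀ L, lyap1 (emp ω L) a = -(S₁ ω L / L) := by
      intro L
      rw [lyap1, sum_emp_mul ω L (fun ij => Real.log (a ij.1))]
      simp only [S₁, hα, Finset.sum_neg_distrib]; ring
    have hS₂L : ∀ L, lyap2 (emp ω L) b = -(S₂ ω L / L) := by
      intro L
      rw [lyap2, sum_emp_mul ω L (fun ij => Real.log (b ij.2))]
      simp only [S₂, hβ, Finset.sum_neg_distrib]; ring
    have hmain := goodLevels_or (S₁ ω) (S₂ ω) (eent ω) (xent ω) (xent fun t => (ω t).swap) a₀ a₁
      ((Fintype.card Γ₁ + Fintype.card Γ₂) / a₀) M (ε / 2) ha₀ h10 h20 hα1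
      (fun L => (hS₁ L).trans_le (ha₁α _)) hβ1 (fun L => (hS₂ L).trans_le (ha₁β _))
      (xent_nonneg ω) ?_ (xent_nonneg _) ?_ hM (by positivity) ?_ ?_
    · rcases hmain with h | h
      · exact Or.inl ⟨ω, hcod, h⟩
      · exact Or.inr ⟨ω, hcod, h⟩
    · intro L
      refine (xent_le ω L).trans ?_
      rw [div_mul_eq_mul_div, le_div_iff₀ ha₀]
      have h1 := hl1 L
      have h2 : (0:ℝ) ≤ Fintype.card Γ₁ := by positivity
      have h3 : (0:ℝ) ≤ Fintype.card Γ₂ := by positivity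
      have h4 : 0 ≤ S₁ ω L := le_trans (by positivity) h1
      nlinarith
    · intro L
      refine (xent_le _ L).trans ?_
      rw [div_mul_eq_mul_div, le_div_iff₀ ha₀]
      have h1 := hl2 L
      have h2 : (0:ℝ) ≤ Fintype.card Γ₁ := by positivity
      have h3 : (0:ℝ) ≤ Fintype.card Γ₂ := by positivity
      have h4 : 0 ≤ S₂ ω L := le_trans (by positivity) h1
      nlinarith
    · intro L hL hle
      have h := hg _ (emp_probVec A ω hωA L hL)
      rw [gFun, hS₁L, hS₂L, if_pos (by
        rw [neg_le_neg_iff]; gcongr), gOne_emp ω a b L hL] at h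
      exact h
    · intro L hL hlt
      have h := hg _ (emp_probVec A ω hωA L hL)
      have hLp : (0:ℝ) < L := by exact_mod_cast hL
      rw [gFun, hS₁L, hS₂L, if_neg (by
        rw [neg_le_neg_iff, not_le]; gcongr), ← gOne_swap] at h
      have h2 : (fun z : Γ₂ × Γ₁ => emp ω L z.swap) = emp (fun t => (ω t).swap) L := by
        ext z; rw [emp_swap]
      rw [h2, gOne_emp _ b a L hL, eent_swap] at h
      exact h
  have hY₁ : dimH Y₁ ≤ ENNReal.ofReal (M + ε / 2 + ε / 2) := by
    refine dimH_limsup_le φ ψ α β hφ hψ hφe hψe (M + ε / 2) (ε / 2) a₀ a₁ (by positivity)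
      (by positivity) ha₀ Y₁ ?_
    rintro z ⟨ω, hc, hG⟩
    exact ⟨ω, hc.1, hc.2, hG⟩
  have hY₂ : dimH Y₂ ≤ ENNReal.ofReal (M + ε / 2 + ε / 2) := by
    rw [← dimH_swap]
    refine dimH_limsup_le ψ φ β α hψ hφ hψe hφe (M + ε / 2) (ε / 2) a₀ a₁ (by positivity)
      (by positivity) ha₀ _ ?_
    rintro _ ⟨z, ⟨ω, hc, hG⟩, rfl⟩
    refine ⟨fun t => (ω t).swap, hc.2, hc.1, ?_⟩
    have : eent (fun t => (ω t).swap) = eent ω := by ext L; exact eent_swap ω L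
    rw [this]
    exact hG
  refine (dimH_mono hsub).trans ?_
  rw [dimH_union]
  refine (max_le hY₁ hY₂).trans ?_
  rw [add_assoc, add_halves, ENNReal.ofReal_add hM hε'.le]
  simp

/-! ### Lower bound: one-dimensional data and a counting lemma -/

theorem compWord_disjoint {Γ : Type*} (f : Γ → ℝ → ℝ) (U : Set ℝ) (hU : ∀ i, f i '' U ⊆ U)
    (hinj : ∀ i, InjOn (f i) U) (hd : Pairwise fun i j => Disjoint (f i '' U) (f j '' U)) :
    ∀ u v : List Γ, u.length = v.length → u ≠ v →
      Disjoint (compWord f u '' U) (compWord f v '' U) := by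
  have hm : ∀ w : List Γ, MapsTo (compWord f w) U U := by
    intro w
    induction w with
    | nil => exact fun x hx => hx
    | cons i w ih => exact fun x hx => hU i ⟨_, ih hx, rfl⟩
  intro u
  induction u with
  | nil => intro v hl hne; exact absurd (List.length_eq_zero_iff.1 hl.symm).symm hne
  | cons i u ih =>
    intro v hl hne
    cases v with
    | nil => simp at hl
    | cons j v =>
      rw [Set.disjoint_left]
      rintro _ ⟨x, hx, rfl⟩ ⟨y, hy, hxy⟩
      have hxy' : f j (compWord f v y) = f i (compWord f u x) := hxy
      by_cases hij : i = j
      · subst hij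
        have huv : u ≠ v := fun h => hne (by rw [h])
        have h1 := hinj i (hm v hy) (hm u hx) hxy'
        exact Set.disjoint_left.1 (ih v (by simpa using hl) huv) ⟨x, hx, rfl⟩ ⟨y, hy, h1⟩
      · exact Set.disjoint_left.1 (hd hij) ⟨_, hm u hx, rfl⟩ ⟨_, hm v hy, hxy'⟩

/-- Abstract one-dimensional data used for the lower bound. -/
structure CData (Γ : Type) where
  φ : Γ → ℝ → ℝ
  N : List Γ → ℝ
  D : ℝ
  hD : 1 ≤ D
  ρ : ℝ
  hρ0 : 0 ≤ ρ
  hρ1 : ρ < 1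
  maps : ∀ i, MapsTo (φ i) (Icc (0:ℝ) 1) (Icc (0:ℝ) 1)
  Npos : ∀ w, 0 < N w
  Nrho : ∀ w, N w ≤ ρ ^ w.length
  up : ∀ w, ∀ x ∈ Icc (0:ℝ) 1, ∀ y ∈ Icc (0:ℝ) 1,
    |compWord φ w x - compWord φ w y| ≤ N w * |x - y|
  low : ∀ w, ∀ x ∈ Icc (0:ℝ) 1, ∀ y ∈ Icc (0:ℝ) 1,
    N w * |x - y| ≤ D * |compWord φ w x - compWord φ w y|
  sup : ∀ u v, N u * N v ≤ D * N (u ++ v)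
  U : Set ℝ
  u0 : ℝ
  u1 : ℝ
  hu : u0 < u1
  huU : Icc u0 u1 ⊆ U
  hUI : U ⊆ Icc 0 1
  hU : ∀ i, φ i '' U ⊆ U
  hUd : Pairwise fun i j => Disjoint (φ i '' U) (φ j '' U)

theorem CData.mapsTo_U {Γ : Type} (C : CData Γ) (w : List Γ) : MapsTo (compWord C.φ w) C.U C.U := by
  induction w with
  | nil => exact fun x hx => hx
  | cons i w ih => exact fun x hx => C.hU i ⟨_, ih hx, rfl⟩

theorem CData.injOn {Γ : Type} (C : CData Γ) (i : Γ) : InjOn (C.φ i) C.U := by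
  intro x hx y hy hxy
  have h := C.low [i] x (C.hUI hx) y (C.hUI hy)
  have h2 : compWord C.φ [i] x - compWord C.φ [i] y = 0 := sub_eq_zero.2 hxy
  rw [h2, abs_zero, mul_zero] at h
  have h3 := C.Npos [i]
  have h4 : |x - y| ≤ 0 := by
    by_contra h5
    push Not at h5
    have := mul_pos h3 h5
    linarith
  exact sub_eq_zero.1 (abs_nonpos_iff.1 h4)

theorem CData.contOn {Γ : Type} (C : CData Γ) (w : List Γ) :
    ContinuousOn (compWord C.φ w) (Icc 0 1) := by
  have : LipschitzOnWith (C.N w).toNNReal (compWord C.φ w) (Icc 0 1) := by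
    refine LipschitzOnWith.of_dist_le_mul fun x hx y hy => ?_
    rw [Real.coe_toNNReal _ (C.Npos w).le]
    exact C.up w x hx y hy
  exact this.continuousOn

theorem CData.count {Γ : Type} [Finite Γ] (C : CData Γ) : ∃ B : ℝ, 0 < B ∧ ∀ r : ℝ, 0 < r →
    ∀ k : ℕ, ∀ E : Set ℝ, (∀ x ∈ E, ∀ y ∈ E, |x - y| ≤ r) → ∀ V : Finset (List Γ),
    (∀ v ∈ V, r ≤ C.N v ∧ ∃ ω : ℕ → Γ, pre ω k = v ∧ ∃ x ∈ E,
      ∀ m, x ∈ compWord C.φ (pre ω m) '' Icc 0 1) → (V.card : ℝ) ≤ B := by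
  classical
  obtain ⟨am, ham, ham'⟩ : ∃ am : ℝ, 0 < am ∧ am ≤ 1 ∧ ∀ i, am ≤ C.N [i] := by
    cases isEmpty_or_nonempty Γ with
    | inl h => exact ⟨1, one_pos, le_rfl, fun i => h.elim i⟩
    | inr h =>
      obtain ⟨i₀, hi₀⟩ := Finite.exists_min (fun i => C.N [i])
      refine ⟨C.N [i₀], C.Npos _, (C.Nrho _).trans (pow_le_one₀ C.hρ0 C.hρ1.le), hi₀⟩
  have hD := C.hD
  have hD0 : 0 < C.D := by linarith
  have hu := C.hu
  have hu0 : C.u0 ∈ Icc (0:ℝ) 1 := C.hUI (C.huU ⟨le_rfl, hu.le⟩)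
  have hu1 : C.u1 ∈ Icc (0:ℝ) 1 := C.hUI (C.huU ⟨hu.le, le_rfl⟩)
  set c : ℝ := C.D⁻¹ * (C.D⁻¹ * am) * (C.u1 - C.u0) with hc
  have hc0 : 0 < c := by
    have : 0 < C.u1 - C.u0 := by linarith
    positivity
  refine ⟨4 / c, by positivity, ?_⟩
  intro r hr k E hE V hV
  -- the intervals
  have hint : ∀ v ∈ V, ∃ y0 y1 : ℝ, c * r ≤ |y1 - y0| ∧ uIcc y0 y1 ⊆ compWord C.φ v '' C.U ∧
      ∃ x ∈ E, uIcc y0 y1 ⊆ Metric.closedBall x r := by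
    intro v hv
    obtain ⟨hrv, ω, hω, x, hxE, hx⟩ := hV v hv
    have hex : ∃ m, k ≤ m ∧ C.N (pre ω m) ≤ r := by
      obtain ⟨m, hm⟩ := exists_pow_lt_of_lt_one hr C.hρ1
      refine ⟨max k m, le_max_left _ _, ?_⟩
      have h1 := C.Nrho (pre ω (max k m))
      rw [pre_length] at h1
      refine h1.trans (le_trans ?_ hm.le)
      exact pow_le_pow_of_le_one C.hρ0 C.hρ1.le (le_max_right _ _)
    obtain ⟨m, ⟨hkm, hmr⟩, hmin⟩ : ∃ m, (k ≤ m ∧ C.N (pre ω m) ≤ r) ∧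
        ∀ m' < m, ¬ (k ≤ m' ∧ C.N (pre ω m') ≤ r) :=
      ⟨Nat.find hex, Nat.find_spec hex, fun K' h => Nat.find_min hex h⟩
    have hlow : C.D⁻¹ * am * r ≤ C.N (pre ω m) := by
      rcases eq_or_lt_of_le hkm with h | h
      · rw [← h, hω]
        refine le_trans ?_ hrv
        have : C.D⁻¹ * am ≤ 1 := by
          have := inv_le_one_of_one_le₀ hD
          have h0 : 0 < C.D⁻¹ := by positivity
          nlinarith [ham'.1]
        nlinarith
      · obtain ⟨m', rfl⟩ : ∃ m', m = m' + 1 := ⟨m - 1, by omega⟩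
        have h2 := hmin m' (by omega)
        have h3 : r < C.N (pre ω m') := by
          by_contra h4
          exact h2 ⟨by omega, not_lt.1 h4⟩
        have h4 := C.sup (pre ω m') [ω m']
        rw [← pre_succ] at h4
        have h5 : am * r ≤ C.D * C.N (pre ω (m' + 1)) := by
          refine le_trans ?_ h4
          rw [mul_comm]
          exact mul_le_mul h3.le (ham'.2 _) ham.le (C.Npos _).le
        rw [mul_assoc, inv_mul_le_iff₀ hD0]
        exact h5
    refine ⟨compWord C.φ (pre ω m) C.u0, compWord C.φ (pre ω m) C.u1, ?_, ?_, x, hxE, ?_⟩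
    · have h := C.low (pre ω m) C.u1 hu1 C.u0 hu0
      rw [abs_of_pos (by linarith : 0 < C.u1 - C.u0)] at h
      have h6 : C.D⁻¹ * am * r * (C.u1 - C.u0) ≤
          C.D * |compWord C.φ (pre ω m) C.u1 - compWord C.φ (pre ω m) C.u0| :=
        le_trans (mul_le_mul_of_nonneg_right hlow (by linarith)) h
      rw [← inv_mul_le_iff₀ hD0] at h6
      calc c * r = C.D⁻¹ * (C.D⁻¹ * am * r * (C.u1 - C.u0)) := by rw [hc]; ring
        _ ≤ _ := h6
    · have hiv := intermediate_value_uIcc (f := compWord C.φ (pre ω m)) (a := C.u0) (b := C.u1)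
        ((C.contOn _).mono (by
          rw [uIcc_of_le hu.le]
          exact C.huU.trans C.hUI))
      rw [uIcc_of_le hu.le] at hiv
      refine hiv.trans ?_
      rintro _ ⟨y, hy, rfl⟩
      obtain ⟨j, rfl⟩ := Nat.exists_eq_add_of_le hkm
      rw [pre_add, hω, compWord_append]
      exact ⟨_, C.mapsTo_U _ (C.huU hy), rfl⟩
    · obtain ⟨x', hx', hxx⟩ := hx m
      have hmem : ∀ y ∈ Icc (0:ℝ) 1, compWord C.φ (pre ω m) y ∈ Metric.closedBall x r := by
        intro y hy
        rw [Metric.mem_closedBall, Real.dist_eq, ← hxx]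
        refine (C.up _ y hy x' hx').trans ?_
        have := abs_sub_le_one hy hx'
        have := C.Npos (pre ω m)
        nlinarith [abs_nonneg (y - x')]
      rw [Real.closedBall_eq_Icc] at hmem ⊢
      exact Set.uIcc_subset_Icc (hmem _ hu0) (hmem _ hu1)
  choose! y0 y1 hlen hsub x hxE hball using hint
  rcases V.eq_empty_or_nonempty with rfl | ⟨v₀, hv₀⟩
  · simp; positivity
  have hdisj : (V : Set (List Γ)).PairwiseDisjoint (fun v => uIcc (y0 v) (y1 v)) := by
    intro v hv w hw hvw
    have hl : v.length = w.length := by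
      obtain ⟨_, ω, hω, _⟩ := hV v hv
      obtain ⟨_, ω', hω', _⟩ := hV w hw
      rw [← hω, ← hω', pre_length, pre_length]
    exact Disjoint.mono (hsub v hv) (hsub w hw)
      (compWord_disjoint C.φ C.U C.hU C.injOn C.hUd v w hl hvw)
  have hvol := measure_biUnion_finset (μ := volume) hdisj
    (fun v _ => (measurableSet_uIcc : MeasurableSet (uIcc (y0 v) (y1 v))))
  have hle : volume (⋃ v ∈ V, uIcc (y0 v) (y1 v)) ≤ volume (Metric.closedBall (x v₀) (2 * r)) := by
    refine measure_mono (Set.iUnion₂_subset fun v hv => (hball v hv).trans ?_)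
    refine Metric.closedBall_subset_closedBall' ?_
    have := hE _ (hxE v hv) _ (hxE v₀ hv₀)
    rw [Real.dist_eq]
    linarith
  rw [hvol, Real.volume_closedBall] at hle
  have h7 : ∑ v ∈ V, ENNReal.ofReal (c * r) ≤ ∑ v ∈ V, volume (uIcc (y0 v) (y1 v)) := by
    refine Finset.sum_le_sum fun v hv => ?_
    rw [Real.volume_interval]
    exact ENNReal.ofReal_le_ofReal (hlen v hv)
  have h8 := h7.trans hle
  rw [Finset.sum_const, nsmul_eq_mul, ← ENNReal.ofReal_natCast,
    ← ENNReal.ofReal_mul (by positivity), ENNReal.ofReal_le_ofReal_iff (by positivity)] at h8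
  rw [le_div_iff₀ hc0]
  have h9 : (V.card * c - 4) * r ≤ 0 := by nlinarith
  by_contra h10
  push Not at h10
  nlinarith

/-! ### Lower bound: mass distribution -/

theorem mass_bound {Γ₁ Γ₂ : Type} [Finite Γ₁] [Finite Γ₂] (C₁ : CData Γ₁) (C₂ : CData Γ₂)
    [MeasurableSpace (Γ₁ × Γ₂)] (μ : Measure (ℕ → Γ₁ × Γ₂)) (π : (ℕ → Γ₁ × Γ₂) → ℝ × ℝ)
    (good : Set (ℕ → Γ₁ × Γ₂))
    (hc1 : ∀ ω ∈ good, ∀ m, (π ω).1 ∈ compWord C₁.φ (pre (fun t => (ω t).1) m) '' Icc 0 1)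
    (hc2 : ∀ ω ∈ good, ∀ m, (π ω).2 ∈ compWord C₂.φ (pre (fun t => (ω t).2) m) '' Icc 0 1)
    (s r₀ C : ℝ) (hC : 0 ≤ C)
    (h : ∀ r, 0 < r → r ≤ r₀ → ∃ k l, ∀ ω ∈ good, r ≤ C₁.N (pre (fun t => (ω t).1) k) ∧
      r ≤ C₂.N (pre (fun t => (ω t).2) l) ∧
      μ {ω' | pre (fun t => (ω' t).1) k = pre (fun t => (ω t).1) k ∧
        pre (fun t => (ω' t).2) l = pre (fun t => (ω t).2) l} ≤ ENNReal.ofReal (C * r ^ s)) :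
    ∃ B : ℝ, 0 ≤ B ∧ ∀ r, 0 < r → r ≤ r₀ → ∀ E : Set (ℝ × ℝ), ediam E ≤ ENNReal.ofReal r →
      μ (π ⁻¹' E ∩ good) ≤ ENNReal.ofReal (B * r ^ s) := by
  classical
  obtain ⟨B₁, hB₁, hcount₁⟩ := C₁.count
  obtain ⟨B₂, hB₂, hcount₂⟩ := C₂.count
  refine ⟨B₁ * B₂ * C, by positivity, ?_⟩
  intro r hr hr₀ E hE
  obtain ⟨k, l, hkl⟩ := h r hr hr₀
  let code : (ℕ → Γ₁ × Γ₂) → List Γ₁ × List Γ₂ :=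
    fun ω => (pre (fun t => (ω t).1) k, pre (fun t => (ω t).2) l)
  have hfin : (code '' (π ⁻¹' E ∩ good)).Finite := by
    refine Set.Finite.subset ((List.finite_length_eq Γ₁ k).prod (List.finite_length_eq Γ₂ l)) ?_
    rintro _ ⟨ω, _, rfl⟩
    exact ⟨pre_length (fun t => (ω t).1) k, pre_length (fun t => (ω t).2) l⟩
  set P := hfin.toFinset with hP
  have hdist : ∀ z ∈ E, ∀ z' ∈ E, |z.1 - z'.1| ≤ r ∧ |z.2 - z'.2| ≤ r := by
    intro z hz z' hz'
    have h1 := (Metric.edist_le_ediam_of_mem hz hz').trans hE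
    rw [edist_dist, ENNReal.ofReal_le_ofReal_iff hr.le, Prod.dist_eq, max_le_iff] at h1
    exact h1
  have hV₁ : ((P.image Prod.fst).card : ℝ) ≤ B₁ := by
    refine hcount₁ r hr k (Prod.fst '' E) ?_ _ ?_
    · rintro _ ⟨z, hz, rfl⟩ _ ⟨z', hz', rfl⟩
      exact (hdist z hz z' hz').1
    · intro v hv
      obtain ⟨vw, hvw, rfl⟩ := Finset.mem_image.1 hv
      obtain ⟨ω, ⟨hωE, hωg⟩, rfl⟩ := (hfin.mem_toFinset).1 hvw
      exact ⟨(hkl ω hωg).1, fun t => (ω t).1, rfl, (π ω).1, ⟨π ω, hωE, rfl⟩, hc1 ω hωg⟩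
  have hV₂ : ((P.image Prod.snd).card : ℝ) ≤ B₂ := by
    refine hcount₂ r hr l (Prod.snd '' E) ?_ _ ?_
    · rintro _ ⟨z, hz, rfl⟩ _ ⟨z', hz', rfl⟩
      exact (hdist z hz z' hz').2
    · intro v hv
      obtain ⟨vw, hvw, rfl⟩ := Finset.mem_image.1 hv
      obtain ⟨ω, ⟨hωE, hωg⟩, rfl⟩ := (hfin.mem_toFinset).1 hvw
      exact ⟨(hkl ω hωg).2.1, fun t => (ω t).2, rfl, (π ω).2, ⟨π ω, hωE, rfl⟩, hc2 ω hωg⟩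
  have hcard : (P.card : ℝ) ≤ B₁ * B₂ := by
    have h1 : P ⊆ (P.image Prod.fst) ×ˢ (P.image Prod.snd) := by
      intro z hz
      exact Finset.mem_product.2 ⟨Finset.mem_image_of_mem _ hz, Finset.mem_image_of_mem _ hz⟩
    have h2 := Finset.card_le_card h1
    rw [Finset.card_product] at h2
    have h3 : (P.card : ℝ) ≤ (P.image Prod.fst).card * (P.image Prod.snd).card := by
      exact_mod_cast h2
    exact h3.trans (mul_le_mul hV₁ hV₂ (by positivity) hB₁.le)
  have hcover : π ⁻¹' E ∩ good ⊆ ⋃ c ∈ P, code ⁻¹' {c} := by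
    intro ω hω
    refine Set.mem_iUnion₂.2 ⟨code ω, (hfin.mem_toFinset).2 ⟨ω, hω, rfl⟩, rfl⟩
  calc μ (π ⁻¹' E ∩ good) ≤ μ (⋃ c ∈ P, code ⁻¹' {c}) := measure_mono hcover
    _ ≤ ∑ c ∈ P, μ (code ⁻¹' {c}) := measure_biUnion_finset_le _ _
    _ ≤ ∑ c ∈ P, ENNReal.ofReal (C * r ^ s) := by
        refine Finset.sum_le_sum fun c hc => ?_
        obtain ⟨ω, ⟨hωE, hωg⟩, rfl⟩ := (hfin.mem_toFinset).1 hc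
        refine le_trans (measure_mono ?_) (hkl ω hωg).2.2
        intro ω' hω'
        have : code ω' = code ω := hω'
        exact ⟨congrArg Prod.fst this, congrArg Prod.snd this⟩
    _ = ENNReal.ofReal (P.card * (C * r ^ s)) := by
        rw [Finset.sum_const, nsmul_eq_mul, ← ENNReal.ofReal_natCast,
          ← ENNReal.ofReal_mul (by positivity)]
    _ ≤ _ := by
        refine ENNReal.ofReal_le_ofReal ?_
        rw [mul_assoc]
        have : 0 ≤ C * r ^ s := by positivity
        nlinarith

theorem dimH_ge_of_mass {Ω : Type} [MeasurableSpace Ω] (μ : Measure Ω) (π : Ω → ℝ × ℝ)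
    (hπ : Measurable π) (good : Set Ω) (hgood : μ good ≠ 0) (X : Set (ℝ × ℝ)) (hXc : IsClosed X)
    (hX : ∀ ω ∈ good, π ω ∈ X) (s r₀ B : ℝ) (hs : 0 < s) (hr₀ : 0 < r₀) (hB0 : 0 ≤ B)
    (hB : ∀ r, 0 < r → r ≤ r₀ → ∀ E : Set (ℝ × ℝ), ediam E ≤ ENNReal.ofReal r →
      μ (π ⁻¹' E ∩ good) ≤ ENNReal.ofReal (B * r ^ s)) :
    ENNReal.ofReal s ≤ dimH X := by
  set ν : Measure (ℝ × ℝ) := (μ.restrict good).map π with hν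
  have hνcl : ∀ E : Set (ℝ × ℝ), IsClosed E → ν E = μ (π ⁻¹' E ∩ good) := by
    intro E hE
    rw [hν, Measure.map_apply hπ hE.measurableSet, Measure.restrict_apply (hπ hE.measurableSet)]
  have hνr : ∀ r, 0 < r → r ≤ r₀ → ∀ E : Set (ℝ × ℝ), ediam E ≤ ENNReal.ofReal r →
      ν E ≤ ENNReal.ofReal (B * r ^ s) := by
    intro r hr hr' E hE
    refine (measure_mono subset_closure).trans ?_
    rw [hνcl _ isClosed_closure]
    exact hB r hr hr' _ (by rwa [Metric.ediam_closure])
  have hν0 : ∀ E : Set (ℝ × ℝ), ediam E = 0 → ν E = 0 := by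
    intro E hE
    have h1 : Tendsto (fun r : ℝ => ENNReal.ofReal (B * r ^ s)) (nhdsWithin 0 (Ioi 0)) (nhds 0) := by
      have h2 : Tendsto (fun r : ℝ => B * r ^ s) (nhds 0) (nhds 0) := by
        have h3 := (Real.continuousAt_rpow_const 0 s (Or.inr hs.le)).tendsto
        rw [Real.zero_rpow hs.ne'] at h3
        simpa using h3.const_mul B
      have h4 := (ENNReal.tendsto_ofReal h2).mono_left (nhdsWithin_le_nhds (s := Ioi 0))
      simpa using h4
    refine le_antisymm (ge_of_tendsto h1 ?_) zero_le
    filter_upwards [Ioc_mem_nhdsGT hr₀] with r hr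
    exact hνr r hr.1 hr.2 E (by rw [hE]; exact zero_le)
  have hνX : ν X ≠ 0 := by
    rw [hνcl X hXc]
    intro h0
    apply hgood
    refine measure_mono_null ?_ h0
    exact fun ω hω => ⟨hX ω hω, hω⟩
  set c : ℝ≥0∞ := ENNReal.ofReal (B + 1) with hc
  have hc0 : c ≠ 0 := by rw [hc]; simp; linarith
  have hct : c ≠ ⊤ := ENNReal.ofReal_ne_top
  have hle : c⁻¹ • ν ≤ μH[s] := by
    refine Measure.le_hausdorffMeasure s _ (ENNReal.ofReal r₀) (by simpa using hr₀) ?_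
    intro E hE
    rw [Measure.smul_apply, smul_eq_mul]
    rcases eq_or_ne (ediam E) 0 with h0 | h0
    · rw [hν0 E h0, mul_zero]; exact zero_le
    · have hfin : ediam E ≠ ⊤ := ne_top_of_le_ne_top ENNReal.ofReal_ne_top hE
      set r := (ediam E).toReal with hr
      have hrE : ediam E = ENNReal.ofReal r := (ENNReal.ofReal_toReal hfin).symm
      have hr0 : 0 < r := ENNReal.toReal_pos h0 hfin
      have hrr : r ≤ r₀ := by
        rw [hrE] at hE
        exact (ENNReal.ofReal_le_ofReal_iff hr₀.le).1 hE
      have h1 := hνr r hr0 hrr E hrE.le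
      rw [hrE, ENNReal.ofReal_rpow_of_pos hr0]
      rw [mul_comm, ← div_eq_mul_inv]
      refine ENNReal.div_le_of_le_mul (h1.trans ?_)
      rw [hc, ← ENNReal.ofReal_mul (by positivity)]
      refine ENNReal.ofReal_le_ofReal ?_
      have : 0 ≤ r ^ s := by positivity
      nlinarith
  have hne : μH[s] X ≠ 0 := by
    intro h0
    have h1 := hle X
    rw [h0, Measure.smul_apply, smul_eq_mul, nonpos_iff_eq_zero, mul_eq_zero] at h1
    rcases h1 with h1 | h1
    · exact hct (ENNReal.inv_eq_zero.1 h1)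
    · exact hνX h1
  have hs' : (s.toNNReal : ℝ) = s := Real.coe_toNNReal s hs.le
  have := le_dimH_of_hausdorffMeasure_ne_zero (d := s.toNNReal) (s := X) (by rwa [hs'])
  exact this

/-! ### Lower bound: Bernoulli measures and the coding map -/

open Classical in
theorem bernoulli_meas {Γ : Type} [Fintype Γ] [MeasurableSpace Γ] [MeasurableSingletonClass Γ]
    (p : Γ → ℝ) (hp0 : ∀ γ, 0 ≤ p γ) (hp1 : ∑ γ, p γ = 1) :
    ∃ μ : Measure (ℕ → Γ), IsProbabilityMeasure μ ∧
      (∀ h : Γ → ℝ, ∀ᵐ ω ∂μ, Tendsto (fun k : ℕ => (∑ t ∈ Finset.range k, h (ω t)) / k) atTop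
        (nhds (∑ γ, p γ * h γ))) ∧
      (∀ᵐ ω ∂μ, ∀ t, 0 < p (ω t)) ∧
      (∀ (k : ℕ) (T : ℕ → Set Γ), μ {ω | ∀ t < k, ω t ∈ T t} =
        ∏ t ∈ Finset.range k, ENNReal.ofReal (∑ γ, if γ ∈ T t then p γ else 0)) := by
  let Q : PMF Γ := PMF.ofFintype (fun γ => ENNReal.ofReal (p γ)) (by
    rw [← ENNReal.ofReal_sum_of_nonneg (fun i _ => hp0 i), hp1, ENNReal.ofReal_one])
  have hQ : ∀ γ, Q γ = ENNReal.ofReal (p γ) := fun γ => rfl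
  have hQT : ∀ T : Set Γ, Q.toMeasure T = ENNReal.ofReal (∑ γ, if γ ∈ T then p γ else 0) := by
    intro T
    rw [PMF.toMeasure_apply_fintype, ENNReal.ofReal_sum_of_nonneg]
    · refine Finset.sum_congr rfl fun γ _ => ?_
      by_cases h : γ ∈ T <;> simp [h, hQ]
    · intro γ _; split_ifs <;> simp [hp0]
  let μ : Measure (ℕ → Γ) := Measure.infinitePi (fun _ => Q.toMeasure)
  have heval : ∀ t : ℕ, μ.map (fun ω => ω t) = Q.toMeasure := fun t =>
    Measure.infinitePi_map_eval (fun _ => Q.toMeasure) t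
  refine ⟨μ, inferInstance, ?_, ?_, ?_⟩
  · intro h
    have hm : Measurable h := measurable_of_finite h
    have hind := ProbabilityTheory.iIndepFun_infinitePi (P := fun _ : ℕ => Q.toMeasure)
      (X := fun _ => h) (fun _ => hm)
    have hslln := ProbabilityTheory.strong_law_ae_real (μ := μ) (fun t ω => h (ω t)) ?_ ?_ ?_
    · have hint : ∫ ω, h (ω 0) ∂μ = ∑ γ, p γ * h γ := by
        have h1 := integral_map (μ := μ) (φ := fun ω : ℕ → Γ => ω 0) (f := h)
          (measurable_pi_apply 0).aemeasurable hm.aestronglyMeasurable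
        rw [← h1, heval, PMF.integral_eq_sum]
        refine Finset.sum_congr rfl fun γ _ => ?_
        rw [hQ, ENNReal.toReal_ofReal (hp0 γ), smul_eq_mul]
      rw [← hint]
      exact hslln
    · have h1 : Integrable h (μ.map (fun ω : ℕ → Γ => ω 0)) := by
        rw [heval]
        exact Integrable.of_finite
      exact (integrable_map_measure hm.aestronglyMeasurable
        (measurable_pi_apply 0).aemeasurable).1 h1
    · intro i j hij
      exact hind.indepFun hij
    · intro i
      have h1 : ProbabilityTheory.IdentDistrib (fun ω : ℕ → Γ => ω i) (fun ω => ω 0) μ μ :=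
        ⟨(measurable_pi_apply i).aemeasurable, (measurable_pi_apply 0).aemeasurable, by
          rw [heval, heval]⟩
      exact h1.comp hm
  · rw [ae_all_iff]
    intro t
    have h1 : ∀ᵐ γ ∂(μ.map (fun ω : ℕ → Γ => ω t)), 0 < p γ := by
      rw [heval, ae_iff, hQT]
      simp only [Set.mem_setOf_eq, not_lt]
      rw [Finset.sum_eq_zero]
      · simp
      · intro γ _
        split_ifs with h
        · exact le_antisymm h (hp0 γ)
        · rfl
    exact ae_of_ae_map (measurable_pi_apply t).aemeasurable h1
  · intro k T
    have h1 := Measure.infinitePi_pi (fun _ : ℕ => Q.toMeasure) (s := Finset.range k) (t := T)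
      (fun i _ => (Set.toFinite _).measurableSet)
    have h2 : {ω : ℕ → Γ | ∀ t < k, ω t ∈ T t} = ((Finset.range k : Finset ℕ) : Set ℕ).pi T := by
      ext ω; simp [Set.mem_pi]
    rw [h2, h1]
    exact Finset.prod_congr rfl fun t _ => hQT _

theorem pre_map {Γ Γ' : Type*} (ω : ℕ → Γ) (g : Γ → Γ') (k : ℕ) :
    (pre ω k).map g = pre (fun t => g (ω t)) k := by
  simp [pre, List.map_ofFn, Function.comp_def]

theorem CData.coding {Γ Γ' : Type} [Finite Γ'] [MeasurableSpace Γ'] [MeasurableSingletonClass Γ']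
    (C : CData Γ) (pr : Γ' → Γ) (x₀ : ℝ) (hx₀ : x₀ ∈ Icc (0:ℝ) 1) :
    ∃ π : (ℕ → Γ') → ℝ, Measurable π ∧
      (∀ ω, Tendsto (fun k => compWord C.φ (pre (fun t => pr (ω t)) k) x₀) atTop (nhds (π ω))) ∧
      ∀ ω m, π ω ∈ compWord C.φ (pre (fun t => pr (ω t)) m) '' Icc 0 1 := by
  have hmem : ∀ (w : List Γ), compWord C.φ w x₀ ∈ Icc (0:ℝ) 1 := fun w =>
    compWord_mapsTo C.φ C.maps w hx₀
  have hca : ∀ ω : ℕ → Γ', CauchySeq (fun k => compWord C.φ (pre (fun t => pr (ω t)) k) x₀) := by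
    intro ω
    refine cauchySeq_of_le_geometric C.ρ 1 C.hρ1 fun k => ?_
    rw [pre_succ, compWord_append, Real.dist_eq, one_mul]
    have hm := hmem [pr (ω k)]
    refine (C.up _ x₀ hx₀ _ hm).trans ?_
    have h1 := C.Nrho (pre (fun t => pr (ω t)) k)
    rw [pre_length] at h1
    have h2 := abs_sub_le_one hx₀ hm
    have h3 := C.Npos (pre (fun t => pr (ω t)) k)
    nlinarith [abs_nonneg (x₀ - compWord C.φ [pr (ω k)] x₀)]
  choose π hπ using fun ω => cauchySeq_tendsto_of_complete (hca ω)
  refine ⟨π, ?_, hπ, ?_⟩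
  · refine measurable_of_tendsto_metrizable
      (f := fun k (ω : ℕ → Γ') => compWord C.φ (pre (fun t => pr (ω t)) k) x₀) ?_
      (tendsto_pi_nhds.2 hπ)
    intro k
    have h1 : Measurable (fun v : Fin k → Γ' => compWord C.φ (List.ofFn fun t => pr (v t)) x₀) :=
      measurable_of_finite _
    have h2 : Measurable (fun ω : ℕ → Γ' => fun t : Fin k => ω t) := by
      refine measurable_pi_lambda _ fun t => measurable_pi_apply _
    exact h1.comp h2
  · intro ω m
    have hcl : IsClosed (compWord C.φ (pre (fun t => pr (ω t)) m) '' Icc 0 1) :=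
      (isCompact_Icc.image_of_continuousOn (C.contOn _)).isClosed
    refine hcl.mem_of_tendsto (hπ ω) ?_
    filter_upwards [eventually_ge_atTop m] with k hk
    obtain ⟨j, rfl⟩ := Nat.exists_eq_add_of_le hk
    rw [pre_add, compWord_append]
    exact ⟨_, hmem _, rfl⟩

theorem orbit_mem {Γ₁ Γ₂ : Type*} (φ : Γ₁ → ℝ → ℝ) (ψ : Γ₂ → ℝ → ℝ) (A : Set (Γ₁ × Γ₂))
    (X : Set (ℝ × ℝ)) (hX : ∀ γ ∈ A, ∀ z ∈ X, (φ γ.1 z.1, ψ γ.2 z.2) ∈ X) (w : List (Γ₁ × Γ₂))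
    (hw : ∀ γ ∈ w, γ ∈ A) (z : ℝ × ℝ) (hz : z ∈ X) :
    (compWord φ (w.map Prod.fst) z.1, compWord ψ (w.map Prod.snd) z.2) ∈ X := by
  induction w with
  | nil => exact hz
  | cons γ w ih =>
    exact hX γ (hw γ (by simp)) _ (ih fun γ' h => hw γ' (by simp [h]))

theorem CData.one_le_nil {Γ : Type} (C : CData Γ) : 1 ≤ C.N [] := by
  have := C.up [] 1 (by simp) 0 (by simp)
  simpa [compWord] using this

theorem CData.N_ge {Γ : Type} (C : CData Γ) (c : ℝ) (hc : Real.log C.D ≤ c) (ω : ℕ → Γ) (k : ℕ) :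
    Real.exp (∑ t ∈ Finset.range k, Real.log (C.N [ω t]) - k * c) ≤ C.N (pre ω k) := by
  have hD : 0 < C.D := by linarith [C.hD]
  induction k with
  | zero => simpa [pre] using C.one_le_nil
  | succ k ih =>
    have h1 := C.sup (pre ω k) [ω k]
    rw [← pre_succ] at h1
    have h2 : Real.exp (-c) * C.D ≤ 1 := by
      calc Real.exp (-c) * C.D = Real.exp (-c) * Real.exp (Real.log C.D) := by
            rw [Real.exp_log hD]
        _ = Real.exp (-c + Real.log C.D) := by rw [Real.exp_add]
        _ ≤ 1 := by rw [Real.exp_le_one_iff]; linarith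
    have h3 : ∑ t ∈ Finset.range (k + 1), Real.log (C.N [ω t]) - ((k + 1 : ℕ) : ℝ) * c =
        (∑ t ∈ Finset.range k, Real.log (C.N [ω t]) - k * c) + Real.log (C.N [ω k]) + -c := by
      rw [Finset.sum_range_succ]; push_cast; ring
    rw [h3, Real.exp_add, Real.exp_add, Real.exp_log (C.Npos _)]
    calc _ ≤ C.N (pre ω k) * C.N [ω k] * Real.exp (-c) := by
          have := C.Npos [ω k]
          gcongr
      _ ≤ C.D * C.N (pre ω (k + 1)) * Real.exp (-c) := by gcongr
      _ = (Real.exp (-c) * C.D) * C.N (pre ω (k + 1)) := by ring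
      _ ≤ 1 * C.N (pre ω (k + 1)) := by
          have := C.Npos (pre ω (k + 1))
          gcongr
      _ = _ := one_mul _

/-! ### Lower bound: main estimate -/

theorem p_le_colSum {Γ₁ Γ₂ : Type*} [Fintype Γ₂] (p : Γ₁ × Γ₂ → ℝ) (hp : ∀ z, 0 ≤ p z)
    (z : Γ₁ × Γ₂) : p z ≤ colSum p z.1 :=
  Finset.single_le_sum (f := fun j => p (z.1, j)) (fun j _ => hp _) (Finset.mem_univ z.2)

theorem colSum_nonneg {Γ₁ Γ₂ : Type*} [Fintype Γ₂] (p : Γ₁ × Γ₂ → ℝ) (hp : ∀ z, 0 ≤ p z)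
    (i : Γ₁) : 0 ≤ colSum p i := Finset.sum_nonneg fun _ _ => hp _

theorem colSum_le_one {Γ₁ Γ₂ : Type*} [Fintype Γ₁] [Fintype Γ₂] (p : Γ₁ × Γ₂ → ℝ)
    (hp : ∀ z, 0 ≤ p z) (h1 : ∑ z, p z = 1) (i : Γ₁) : colSum p i ≤ 1 := by
  rw [← h1, Fintype.sum_prod_type]
  exact Finset.single_le_sum (f := fun i => colSum p i) (fun j _ => colSum_nonneg p hp j)
    (Finset.mem_univ i)

theorem ent1_nonneg {Γ₁ Γ₂ : Type*} [Fintype Γ₁] [Fintype Γ₂] (p : Γ₁ × Γ₂ → ℝ)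
    (hp : ∀ z, 0 ≤ p z) (h1 : ∑ z, p z = 1) :
    0 ≤ -∑ z : Γ₁ × Γ₂, p z * Real.log (colSum p z.1) := by
  rw [neg_nonneg]
  exact Finset.sum_nonpos fun z _ => mul_nonpos_of_nonneg_of_nonpos (hp z)
    (Real.log_nonpos (colSum_nonneg p hp _) (colSum_le_one p hp h1 _))

theorem ent2_nonneg {Γ₁ Γ₂ : Type*} [Fintype Γ₁] [Fintype Γ₂] (p : Γ₁ × Γ₂ → ℝ)
    (hp : ∀ z, 0 ≤ p z) :
    0 ≤ ∑ z : Γ₁ × Γ₂, p z * Real.log (colSum p z.1) - ∑ z : Γ₁ × Γ₂, p z * Real.log (p z) := by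
  rw [sub_nonneg]
  refine Finset.sum_le_sum fun z _ => ?_
  rcases (hp z).eq_or_lt with h | h
  · rw [← h]; simp
  · exact mul_le_mul_of_nonneg_left (Real.log_le_log h (p_le_colSum p hp z)) (hp z)

theorem lyap1_neg {Γ₁ Γ₂ : Type*} [Fintype Γ₁] [Fintype Γ₂] (p : Γ₁ × Γ₂ → ℝ)
    (hp : ∀ z, 0 ≤ p z) (h1 : ∑ z, p z = 1) (a : Γ₁ → ℝ) (m : ℝ) (ha : ∀ i, Real.log (a i) ≤ m) :
    lyap1 p a ≤ m := by
  calc lyap1 p a ≤ ∑ z, p z * m :=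
        Finset.sum_le_sum fun z _ => mul_le_mul_of_nonneg_left (ha _) (hp z)
    _ = m := by rw [← Finset.sum_mul, h1, one_mul]

theorem lyap2_neg {Γ₁ Γ₂ : Type*} [Fintype Γ₁] [Fintype Γ₂] (p : Γ₁ × Γ₂ → ℝ)
    (hp : ∀ z, 0 ≤ p z) (h1 : ∑ z, p z = 1) (b : Γ₂ → ℝ) (m : ℝ) (hb : ∀ i, Real.log (b i) ≤ m) :
    lyap2 p b ≤ m := by
  calc lyap2 p b ≤ ∑ z, p z * m :=
        Finset.sum_le_sum fun z _ => mul_le_mul_of_nonneg_left (hb _) (hp z)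
    _ = m := by rw [← Finset.sum_mul, h1, one_mul]

theorem eventually_sum_ge (S : ℕ → ℝ) (m ε : ℝ) (hε : 0 < ε)
    (h : Tendsto (fun k : ℕ => S k / k) atTop (nhds m)) :
    ∀ᶠ k : ℕ in atTop, k * (m - ε) ≤ S k ∧ S k ≤ k * (m + ε) := by
  filter_upwards [h.eventually (Ioo_mem_nhds (by linarith : m - ε < m) (by linarith : m < m + ε)),
    eventually_ge_atTop 1] with k hk hk1
  have hk0 : (0:ℝ) < k := by exact_mod_cast hk1
  have h1 := hk.1
  have h2 := hk.2
  rw [lt_div_iff₀ hk0] at h1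
  rw [div_lt_iff₀ hk0] at h2
  constructor <;> linarith

theorem lower_bound_eps {Γ₁ Γ₂ : Type} [Fintype Γ₁] [Fintype Γ₂] (C₁ : CData Γ₁) (C₂ : CData Γ₂)
    (c : ℝ) (hc₁ : Real.log C₁.D ≤ c) (hc₂ : Real.log C₂.D ≤ c) (hc0 : 0 ≤ c)
    (A : Set (Γ₁ × Γ₂)) (X : Set (ℝ × ℝ)) (hXne : X.Nonempty) (hXc : IsClosed X)
    (hXI : X ⊆ Icc (0:ℝ) 1 ×ˢ Icc (0:ℝ) 1)
    (hX : ∀ γ ∈ A, ∀ z ∈ X, (C₁.φ γ.1 z.1, C₂.φ γ.2 z.2) ∈ X)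
    (p : Γ₁ × Γ₂ → ℝ) (hp : IsProbVec A p) (h1 h2 l1 l2 : ℝ)
    (hh1 : h1 = -∑ z : Γ₁ × Γ₂, p z * Real.log (colSum p z.1))
    (hh2 : h2 = ∑ z : Γ₁ × Γ₂, p z * Real.log (colSum p z.1) - ∑ z, p z * Real.log (p z))
    (hl1 : l1 = lyap1 p (fun i => C₁.N [i])) (hl2 : l2 = lyap2 p (fun i => C₂.N [i]))
    (hl10 : l1 ≤ 0) (hle : l2 ≤ l1) (ε : ℝ) (hε : 0 < ε) :
    ENNReal.ofReal ((h1 - ε) / (-l1 + c + ε) + (h2 - ε) / (-l2 + c + ε)) ≤ dimH X := by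
  classical
  obtain ⟨hp0, hpA, hp1⟩ := hp
  set s := (h1 - ε) / (-l1 + c + ε) + (h2 - ε) / (-l2 + c + ε) with hs
  rcases le_or_gt s 0 with hs0 | hs0
  · rw [ENNReal.ofReal_of_nonpos hs0]; exact zero_le
  have hh10 : 0 ≤ h1 := hh1 ▸ ent1_nonneg p hp0 hp1
  have hh20 : 0 ≤ h2 := hh2 ▸ ent2_nonneg p hp0
  set a1 := -l1 + c + ε with ha1
  set a2 := -l2 + c + ε with ha2
  have ha10 : 0 < a1 := by linarith
  have ha12 : a1 ≤ a2 := by linarith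
  have ha20 : 0 < a2 := by linarith
  letI : MeasurableSpace (Γ₁ × Γ₂) := ⊤
  haveI : MeasurableSingletonClass (Γ₁ × Γ₂) := ⟨fun _ => trivial⟩
  obtain ⟨μ, hμ, hslln, hpos, hcyl⟩ := bernoulli_meas p hp0 hp1
  obtain ⟨z₀, hz₀⟩ := hXne
  obtain ⟨π₁, hπ₁m, hπ₁t, hπ₁⟩ := C₁.coding (Prod.fst : Γ₁ × Γ₂ → Γ₁) z₀.1 (hXI hz₀).1
  obtain ⟨π₂, hπ₂m, hπ₂t, hπ₂⟩ := C₂.coding (Prod.snd : Γ₁ × Γ₂ → Γ₂) z₀.2 (hXI hz₀).2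
  let π : (ℕ → Γ₁ × Γ₂) → ℝ × ℝ := fun ω => (π₁ ω, π₂ ω)
  have hπm : Measurable π := hπ₁m.prodMk hπ₂m
  let fa : Γ₁ × Γ₂ → ℝ := fun γ => Real.log (C₁.N [γ.1])
  let fb : Γ₁ × Γ₂ → ℝ := fun γ => Real.log (C₂.N [γ.2])
  let fq : Γ₁ × Γ₂ → ℝ := fun γ => Real.log (colSum p γ.1)
  let fp : Γ₁ × Γ₂ → ℝ := fun γ => Real.log (p γ) - Real.log (colSum p γ.1)
  let S : (Γ₁ × Γ₂ → ℝ) → (ℕ → Γ₁ × Γ₂) → ℕ → ℝ := fun h ω k => ∑ t ∈ Finset.range k, h (ω t)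
  let good : ℕ → Set (ℕ → Γ₁ × Γ₂) := fun N => {ω | (∀ t, 0 < p (ω t)) ∧ ∀ k ≥ N,
    k * (l1 - ε) ≤ S fa ω k ∧ k * (l2 - ε) ≤ S fb ω k ∧ S fq ω k ≤ k * (-h1 + ε) ∧
    S fp ω k ≤ k * (-h2 + ε)}
  have hfq : ∑ z, p z * fq z = -h1 := by rw [hh1, neg_neg]
  have hfp : ∑ z, p z * fp z = -h2 := by
    rw [hh2, neg_sub, ← Finset.sum_sub_distrib]
    exact Finset.sum_congr rfl fun z _ => by simp only [fp]; ring
  have hfa : ∑ z, p z * fa z = l1 := by rw [hl1]; rfl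
  have hfb : ∑ z, p z * fb z = l2 := by rw [hl2]; rfl
  obtain ⟨N, hN⟩ : ∃ N, μ (good N) ≠ 0 := by
    by_contra hcon
    push Not at hcon
    have hU : μ (⋃ N, good N) = 0 := measure_iUnion_null hcon
    have hae : ∀ᵐ ω ∂μ, ω ∈ ⋃ N, good N := by
      filter_upwards [hpos, hslln fa, hslln fb, hslln fq, hslln fp] with ω h0 ha hb hq hp
      rw [hfa] at ha
      rw [hfb] at hb
      rw [hfq] at hq
      rw [hfp] at hp
      have hev := ((eventually_sum_ge (S fa ω) l1 ε hε ha).and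
        (eventually_sum_ge (S fb ω) l2 ε hε hb)).and
        ((eventually_sum_ge (S fq ω) (-h1) ε hε hq).and
        (eventually_sum_ge (S fp ω) (-h2) ε hε hp))
      obtain ⟨N, hN⟩ := eventually_atTop.1 hev
      refine Set.mem_iUnion.2 ⟨N, h0, fun k hk => ?_⟩
      obtain ⟨⟨h1, h2⟩, h3, h4⟩ := hN k hk
      exact ⟨h1.1, h2.1, h3.2, h4.2⟩
    have h3 : μ (Set.univ) = 0 := by
      have h4 : μ (⋃ N, good N)ᶜ = 0 := hae
      refine measure_mono_null (t := (⋃ N, good N) ∪ (⋃ N, good N)ᶜ) (by rw [Set.union_compl_self]) ?_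
      exact measure_union_null hU h4
    simp at h3
  have hgX : ∀ ω ∈ good N, π ω ∈ X := by
    intro ω hω
    refine hXc.mem_of_tendsto ((hπ₁t ω).prodMk_nhds (hπ₂t ω)) (Eventually.of_forall fun k => ?_)
    have h := orbit_mem C₁.φ C₂.φ A X hX (pre ω k) ?_ z₀ hz₀
    · rwa [pre_map, pre_map] at h
    · intro γ hγ
      obtain ⟨t, rfl⟩ := (List.mem_ofFn' _ _).1 hγ
      by_contra hA
      exact (hω.1 t).ne' (hpA _ hA)
  have hmass : ∀ r, 0 < r → r ≤ Real.exp (-((N + 1) * a2)) → ∃ k l, ∀ ω ∈ good N,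
      r ≤ C₁.N (pre (fun t => (ω t).1) k) ∧ r ≤ C₂.N (pre (fun t => (ω t).2) l) ∧
      μ {ω' | pre (fun t => (ω' t).1) k = pre (fun t => (ω t).1) k ∧
        pre (fun t => (ω' t).2) l = pre (fun t => (ω t).2) l} ≤
        ENNReal.ofReal (Real.exp (h1 + h2) * r ^ s) := by
    intro r hr hrr
    set R := -Real.log r with hR
    have hr' : r = Real.exp (-R) := by rw [hR, neg_neg, Real.exp_log hr]
    have hRN : (N + 1) * a2 ≤ R := by
      rw [hr', Real.exp_le_exp] at hrr
      linarith
    have hR0 : 0 ≤ R := le_trans (by positivity) hRN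
    set k := ⌊R / a1⌋₊ with hk
    set l := ⌊R / a2⌋₊ with hl
    have hk1 : (k:ℝ) ≤ R / a1 := Nat.floor_le (by positivity)
    have hk2 : R / a1 < k + 1 := Nat.lt_floor_add_one _
    have hll1 : (l:ℝ) ≤ R / a2 := Nat.floor_le (by positivity)
    have hll2 : R / a2 < l + 1 := Nat.lt_floor_add_one _
    have hlk : l ≤ k := Nat.floor_le_floor (div_le_div_of_nonneg_left hR0 ha10 ha12)
    have hNl : N ≤ l := by
      refine Nat.le_floor ?_
      rw [le_div_iff₀ ha20]
      linarith
    have hk3 : k * a1 ≤ R := (le_div_iff₀ ha10).1 hk1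
    have hl3 : l * a2 ≤ R := (le_div_iff₀ ha20).1 hll1
    refine ⟨k, l, fun ω hω => ⟨?_, ?_, ?_⟩⟩
    · refine le_trans ?_ (C₁.N_ge c hc₁ _ k)
      rw [hr', Real.exp_le_exp]
      have h := (hω.2 k (hNl.trans hlk)).1
      simp only [S, fa] at h
      have : (k:ℝ) * a1 = -(k * (l1 - ε)) + k * c := by rw [ha1]; ring
      linarith
    · refine le_trans ?_ (C₂.N_ge c hc₂ _ l)
      rw [hr', Real.exp_le_exp]
      have h := (hω.2 l hNl).2.1
      simp only [S, fb] at h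
      have : (l:ℝ) * a2 = -(l * (l2 - ε)) + l * c := by rw [ha2]; ring
      linarith
    · let T : ℕ → Set (Γ₁ × Γ₂) := fun t => if t < l then {ω t} else {γ | γ.1 = (ω t).1}
      have hsub : {ω' : ℕ → Γ₁ × Γ₂ | pre (fun t => (ω' t).1) k = pre (fun t => (ω t).1) k ∧
          pre (fun t => (ω' t).2) l = pre (fun t => (ω t).2) l} ⊆ {ω' | ∀ t < k, ω' t ∈ T t} := by
        rintro ω' ⟨e1, e2⟩ t ht
        have f1 := congrFun (List.ofFn_injective e1) ⟨t, ht⟩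
        simp only at f1
        simp only [T]
        split_ifs with htl
        · have f2 := congrFun (List.ofFn_injective e2) ⟨t, htl⟩
          exact Prod.ext f1 f2
        · exact f1
      refine (measure_mono hsub).trans ?_
      rw [hcyl]
      have hterm : ∀ t, (∑ γ, if γ ∈ T t then p γ else 0) =
          Real.exp (fq (ω t) + if t < l then fp (ω t) else 0) := by
        intro t
        have hpt := hω.1 t
        have hqt : 0 < colSum p (ω t).1 := hpt.trans_le (p_le_colSum p hp0 _)
        by_cases htl : t < l
        · have : ∀ γ, (γ ∈ T t) ↔ γ = ω t := by intro γ; simp [T, htl]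
          simp only [this, Finset.sum_ite_eq', Finset.mem_univ, if_true, htl, fq, fp]
          rw [add_sub_cancel, Real.exp_log hpt]
        · have : ∀ γ, (γ ∈ T t) ↔ γ.1 = (ω t).1 := by intro γ; simp [T, htl]
          simp only [this, htl, if_false, fq, add_zero]
          rw [Real.exp_log hqt, Fintype.sum_prod_type, Finset.sum_eq_single (ω t).1]
          · simp [colSum]
          · intro i _ hi; simp [hi]
          · simp
      simp only [hterm]
      rw [← ENNReal.ofReal_prod_of_nonneg (fun _ _ => (Real.exp_pos _).le), ← Real.exp_sum,
        Finset.sum_add_distrib]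
      have hite : ∑ t ∈ Finset.range k, (if t < l then fp (ω t) else 0) = S fp ω l := by
        rw [← Finset.sum_filter]
        refine Finset.sum_congr ?_ fun _ _ => rfl
        ext t
        simp only [Finset.mem_filter, Finset.mem_range]
        omega
      rw [hite]
      refine ENNReal.ofReal_le_ofReal ?_
      rw [hr', ← Real.exp_mul, ← Real.exp_add, Real.exp_le_exp]
      have g1 := (hω.2 k (hNl.trans hlk)).2.2.1
      have g2 := (hω.2 l hNl).2.2.2
      have e : -R * s = -(R / a1) * h1 + (R / a1) * ε + (-(R / a2) * h2 + (R / a2) * ε) := by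
        rw [hs]; field_simp; ring
      rw [e]
      simp only [S] at g1 g2 ⊢
      nlinarith
  obtain ⟨B, hB0, hB⟩ := mass_bound C₁ C₂ μ π (good N) (fun ω _ m => hπ₁ ω m)
    (fun ω _ m => hπ₂ ω m) s (Real.exp (-((N + 1) * a2))) (Real.exp (h1 + h2)) (Real.exp_pos _).le
    hmass
  exact dimH_ge_of_mass μ π hπm (good N) hN X hXc hgX s _ B hs0 (Real.exp_pos _) hB0 hB

theorem lower_bound {Γ₁ Γ₂ : Type} [Fintype Γ₁] [Fintype Γ₂] (C₁ : CData Γ₁) (C₂ : CData Γ₂)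
    (c : ℝ) (hc₁ : Real.log C₁.D ≤ c) (hc₂ : Real.log C₂.D ≤ c) (hc0 : 0 ≤ c)
    (A : Set (Γ₁ × Γ₂)) (X : Set (ℝ × ℝ)) (hXne : X.Nonempty) (hXc : IsClosed X)
    (hXI : X ⊆ Icc (0:ℝ) 1 ×ˢ Icc (0:ℝ) 1)
    (hX : ∀ γ ∈ A, ∀ z ∈ X, (C₁.φ γ.1 z.1, C₂.φ γ.2 z.2) ∈ X)
    (p : Γ₁ × Γ₂ → ℝ) (hp : IsProbVec A p) (l1 l2 m : ℝ) (hm : 0 < m)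
    (hl1 : l1 = lyap1 p (fun i => C₁.N [i])) (hl2 : l2 = lyap2 p (fun i => C₂.N [i]))
    (hl10 : l1 ≤ -m) (hle : l2 ≤ l1) :
    ENNReal.ofReal (gOne p (fun i => C₁.N [i]) (fun i => C₂.N [i])) ≤
      ENNReal.ofReal (1 + c / m) * dimH X := by
  set h1 := -∑ z : Γ₁ × Γ₂, p z * Real.log (colSum p z.1) with hh1
  set h2 := ∑ z : Γ₁ × Γ₂, p z * Real.log (colSum p z.1) - ∑ z, p z * Real.log (p z) with hh2
  have hh10 : 0 ≤ h1 := ent1_nonneg p hp.1 hp.2.2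
  have hh20 : 0 ≤ h2 := ent2_nonneg p hp.1
  have hlim : ENNReal.ofReal (h1 / (-l1 + c) + h2 / (-l2 + c)) ≤ dimH X := by
    have ht : Tendsto (fun ε : ℝ => ENNReal.ofReal
        ((h1 - ε) / (-l1 + c + ε) + (h2 - ε) / (-l2 + c + ε))) (nhdsWithin 0 (Ioi 0))
        (nhds (ENNReal.ofReal (h1 / (-l1 + c) + h2 / (-l2 + c)))) := by
      refine (ENNReal.tendsto_ofReal ?_).mono_left nhdsWithin_le_nhds
      have hcont : ContinuousAt (fun ε : ℝ =>
          (h1 - ε) / (-l1 + c + ε) + (h2 - ε) / (-l2 + c + ε)) 0 := by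
        refine ContinuousAt.add (ContinuousAt.div (by fun_prop) (by fun_prop) ?_)
          (ContinuousAt.div (by fun_prop) (by fun_prop) ?_)
        · have : 0 < -l1 + c := by linarith
          simp [this.ne']
        · have : 0 < -l2 + c := by linarith
          simp [this.ne']
      have := hcont.tendsto
      simpa using this
    refine le_of_tendsto ht ?_
    filter_upwards [self_mem_nhdsWithin] with ε hε
    exact lower_bound_eps C₁ C₂ c hc₁ hc₂ hc0 A X hXne hXc hXI hX p hp h1 h2 l1 l2 hh1 hh2 hl1 hl2
      (by linarith) hle ε hε
  have hk0 : 0 ≤ 1 + c / m := by positivity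
  refine le_trans ?_ (mul_le_mul_right hlim _)
  rw [← ENNReal.ofReal_mul hk0]
  refine ENNReal.ofReal_le_ofReal ?_
  have hg : gOne p (fun i => C₁.N [i]) (fun i => C₂.N [i]) = h1 / (-l1) + h2 / (-l2) := by
    unfold gOne
    rw [← hl1, ← hl2, hh1, hh2, neg_div_neg_eq, ← neg_div_neg_eq (_ - _) l2, neg_sub]
  rw [hg, mul_add]
  have key : ∀ h l : ℝ, 0 ≤ h → l ≤ -m → h / (-l) ≤ (1 + c / m) * (h / (-l + c)) := by
    intro h l hh hl
    have hl0 : 0 < -l := by linarith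
    rw [← mul_div_assoc, div_le_div_iff₀ hl0 (by linarith)]
    have h3 : c ≤ c / m * (-l) := by
      rw [div_mul_eq_mul_div, le_div_iff₀ hm]
      nlinarith
    nlinarith
  exact add_le_add (key h1 l1 hh10 hl10) (key h2 l2 hh20 (by linarith))

/-! ### Block systems -/

theorem compWord_flat {Λ : Type*} (f : Λ → ℝ → ℝ) (n : ℕ) (w : List (Fin n → Λ)) :
    compWord (fun i : Fin n → Λ => compWord f (List.ofFn i)) w =
      compWord f (w.flatMap fun i => List.ofFn i) := by
  induction w with
  | nil => rfl
  | cons i w ih =>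
    rw [List.flatMap_cons, compWord_append, ← ih]
    rfl

theorem flat_length {Λ : Type*} (n : ℕ) (w : List (Fin n → Λ)) :
    (w.flatMap fun i => List.ofFn i).length = n * w.length := by
  induction w with
  | nil => simp
  | cons i w ih => rw [List.flatMap_cons, List.length_append, ih]; simp; ring

theorem exists_Icc_subset (U : Set ℝ) (hne : U.Nonempty) (O : Set ℝ) (hO : IsOpen O)
    (hU : U = O ∩ Icc 0 1) : ∃ u0 u1, u0 < u1 ∧ Icc u0 u1 ⊆ U := by
  obtain ⟨x, hx⟩ := hne
  rw [hU] at hx ⊢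
  obtain ⟨δ, hδ, hb⟩ := Metric.isOpen_iff.1 hO x hx.1
  have hx0 := hx.2.1
  have hx1 := hx.2.2
  have hmem : ∀ y, |y - x| < δ → y ∈ O := fun y hy => hb (by rwa [Metric.mem_ball, Real.dist_eq])
  rcases hx1.lt_or_eq with h | h
  · refine ⟨x, min 1 (x + δ / 2), lt_min h (by linarith), fun y hy => ⟨hmem y ?_, ?_, ?_⟩⟩
    · have h2 := hy.2.trans (min_le_right _ _)
      rw [abs_lt]; constructor <;> linarith [hy.1]
    · linarith [hy.1]
    · exact hy.2.trans (min_le_left _ _)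
  · refine ⟨max 0 (x - δ / 2), x, max_lt (by linarith) (by linarith), fun y hy => ⟨hmem y ?_, ?_, ?_⟩⟩
    · have h2 := (le_max_right _ _).trans hy.1
      rw [abs_lt]; constructor <;> linarith [hy.2]
    · exact (le_max_left _ _).trans hy.1
    · linarith [hy.2]

theorem exists_CData {Λ : Type} [Finite Λ] (F : ConformalIFS Λ) (hF : CoordOSC F) :
    ∃ D : ℝ, 1 ≤ D ∧ ∀ n : ℕ, 1 ≤ n → ∃ C : CData (Fin n → Λ), C.D = D ∧
      C.φ = (fun i => compWord F.f (List.ofFn i)) ∧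
      ∀ i, C.N [i] = wordDerivNorm F.f F.f' (List.ofFn i) := by
  obtain ⟨D, hD, hdist⟩ := distortion F
  obtain ⟨U, hUne, hUI, ⟨O, hO, hUO⟩, hUm, hUd⟩ := hF
  obtain ⟨u0, u1, hu, huU⟩ := exists_Icc_subset U hUne O hO hUO
  refine ⟨D, hD, fun n hn => ?_⟩
  have hD0 : 0 < D := by linarith
  have hnorm : ∀ w, ∀ z ∈ Icc (0:ℝ) 1, wordDerivNorm F.f F.f' w ≤ D * |wordDeriv F.f F.f' w z| :=
    fun w z hz => wordDerivNorm_le F w _ fun x hx => hdist w x hx z hz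
  have hinj : ∀ i, InjOn (F.f i) U := by
    intro i x hx y hy hxy
    obtain ⟨z, hz, h⟩ := compWord_mvt F [i] x y (hUI hx) (hUI hy)
    have h0 : compWord F.f [i] x - compWord F.f [i] y = 0 := sub_eq_zero.2 hxy
    rw [h0, abs_zero, eq_comm, mul_eq_zero, abs_eq_zero, abs_eq_zero] at h
    rcases h with h | h
    · exact absurd h (wordDeriv_ne F [i] z hz)
    · exact sub_eq_zero.1 h
  have hmU : ∀ w : List Λ, MapsTo (compWord F.f w) U U := by
    intro w
    induction w with
    | nil => exact fun x hx => hx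
    | cons i w ih => exact fun x hx => hUm i ⟨_, ih hx, rfl⟩
  let fl : List (Fin n → Λ) → List Λ := fun w => w.flatMap fun i => List.ofFn i
  refine ⟨{
    φ := fun i => compWord F.f (List.ofFn i)
    N := fun w => wordDerivNorm F.f F.f' (fl w)
    D := D
    hD := hD
    ρ := F.ratio
    hρ0 := F.ratio_pos.le
    hρ1 := F.ratio_lt_one
    maps := fun i => compWord_mapsTo F.f F.mapsTo _
    Npos := fun w => wordDerivNorm_pos F _
    Nrho := ?_
    up := ?_
    low := ?_
    sup := ?_
    U := U
    u0 := u0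
    u1 := u1
    hu := hu
    huU := huU
    hUI := hUI
    hU := ?_
    hUd := ?_ }, rfl, rfl, ?_⟩
  · intro w
    refine (wordDerivNorm_le_ratio F _).trans ?_
    refine pow_le_pow_of_le_one F.ratio_pos.le F.ratio_lt_one.le ?_
    simp only [fl, flat_length]
    exact Nat.le_mul_of_pos_left _ (by omega)
  · intro w x hx y hy
    rw [compWord_flat]
    exact compWord_lip F _ x y hx hy
  · intro w x hx y hy
    rw [compWord_flat]
    obtain ⟨z, hz, h⟩ := compWord_mvt F (w.flatMap fun i => List.ofFn i) x y hx hy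
    rw [h, ← mul_assoc]
    exact mul_le_mul_of_nonneg_right (hnorm _ z hz) (abs_nonneg _)
  · intro u v
    have hfl : fl (u ++ v) = fl u ++ fl v := by simp [fl]
    rw [hfl]
    have hNu := wordDerivNorm_pos F (fl u)
    rw [mul_comm, ← le_div_iff₀ hNu]
    refine wordDerivNorm_le F _ _ fun x hx => ?_
    rw [le_div_iff₀ hNu]
    have hx' := compWord_mapsTo F.f F.mapsTo (fl v) hx
    calc |wordDeriv F.f F.f' (fl v) x| * wordDerivNorm F.f F.f' (fl u)
        ≤ |wordDeriv F.f F.f' (fl v) x| *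
          (D * |wordDeriv F.f F.f' (fl u) (compWord F.f (fl v) x)|) :=
          mul_le_mul_of_nonneg_left (hnorm _ _ hx') (abs_nonneg _)
      _ = D * |wordDeriv F.f F.f' (fl u ++ fl v) x| := by
          rw [wordDeriv_append, abs_mul]; ring
      _ ≤ _ := mul_le_mul_of_nonneg_left (le_wordDerivNorm F _ x hx) hD0.le
  · intro i
    exact (hmU _).image_subset
  · intro i j hij
    refine compWord_disjoint F.f U hUm hinj hUd _ _ (by simp) ?_
    exact fun h => hij (List.ofFn_injective h)
  · intro i
    simp [fl]

theorem block_cover {Λ₁ Λ₂ : Type*} (F : ConformalIFS Λ₁) (G : ConformalIFS Λ₂)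
    (A : Set (Λ₁ × Λ₂)) (X : Set (ℝ × ℝ)) (hX : IsCarpetAttractor F G A X) (n : ℕ) :
    ∀ z ∈ X, ∃ γ ∈ blockAlphabet A n, ∃ z' ∈ X,
      z = (compWord F.f (List.ofFn γ.1) z'.1, compWord G.f (List.ofFn γ.2) z'.2) := by
  intro z hz
  obtain ⟨ω, hωA, hω⟩ := exists_coding F.f G.f A X (by
    intro z hz
    rw [hX.2.2.2] at hz
    obtain ⟨γ, hγ, z', hz', rfl⟩ := Set.mem_iUnion₂.1 hz
    exact ⟨γ, hγ, z', hz', rfl⟩) z hz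
  obtain ⟨z', hz', h1, h2⟩ := hω n
  exact ⟨(fun t => (ω t).1, fun t => (ω t).2), fun k => hωA k, z', hz', Prod.ext h1 h2⟩

theorem block_inv {Λ₁ Λ₂ : Type*} (F : ConformalIFS Λ₁) (G : ConformalIFS Λ₂)
    (A : Set (Λ₁ × Λ₂)) (X : Set (ℝ × ℝ)) (hX : IsCarpetAttractor F G A X) (n : ℕ) :
    ∀ γ ∈ blockAlphabet A n, ∀ z ∈ X,
      (compWord F.f (List.ofFn γ.1) z.1, compWord G.f (List.ofFn γ.2) z.2) ∈ X := by
  intro γ hγ z hz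
  have h := orbit_mem F.f G.f A X (by
    intro γ hγ z hz
    rw [hX.2.2.2]
    exact Set.mem_iUnion₂.2 ⟨γ, hγ, z, hz, rfl⟩) (List.ofFn fun t => (γ.1 t, γ.2 t)) (by
    intro g hg
    obtain ⟨t, rfl⟩ := (List.mem_ofFn' _ _).1 hg
    exact hγ t) z hz
  rw [List.map_ofFn, List.map_ofFn] at h
  exact h

/-! ### Existence of maximizers -/

theorem sum_log_colSum {Γ₁ Γ₂ : Type*} [Fintype Γ₁] [Fintype Γ₂] (p : Γ₁ × Γ₂ → ℝ) :
    ∑ z : Γ₁ × Γ₂, p z * Real.log (colSum p z.1) = ∑ i, colSum p i * Real.log (colSum p i) := by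
  rw [Fintype.sum_prod_type]
  refine Finset.sum_congr rfl fun i _ => ?_
  simp only [colSum, Finset.sum_mul]

theorem continuousOn_gOne {Γ₁ Γ₂ : Type*} [Fintype Γ₁] [Fintype Γ₂] (a : Γ₁ → ℝ) (b : Γ₂ → ℝ)
    (S : Set (Γ₁ × Γ₂ → ℝ)) (h1 : ∀ p ∈ S, lyap1 p a ≠ 0) (h2 : ∀ p ∈ S, lyap2 p b ≠ 0) :
    ContinuousOn (fun p => gOne p a b) S := by
  have hl1 : Continuous fun p : Γ₁ × Γ₂ → ℝ => lyap1 p a := by unfold lyap1; fun_prop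
  have hl2 : Continuous fun p : Γ₁ × Γ₂ → ℝ => lyap2 p b := by unfold lyap2; fun_prop
  have hq : Continuous fun p : Γ₁ × Γ₂ → ℝ =>
      ∑ z : Γ₁ × Γ₂, p z * Real.log (colSum p z.1) := by
    simp only [sum_log_colSum]
    refine continuous_finsetSum _ fun i _ => ?_
    exact Real.continuous_mul_log.comp (f := fun p : Γ₁ × Γ₂ → ℝ => colSum p i)
      (by unfold colSum; fun_prop)
  have hp : Continuous fun p : Γ₁ × Γ₂ → ℝ => ∑ z : Γ₁ × Γ₂, p z * Real.log (p z) := by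
    refine continuous_finsetSum _ fun i _ => ?_
    exact Real.continuous_mul_log.comp (f := fun p : Γ₁ × Γ₂ → ℝ => p i) (by fun_prop)
  unfold gOne
  exact (hq.continuousOn.div hl1.continuousOn h1).add
    ((hp.sub hq).continuousOn.div hl2.continuousOn h2)

theorem probVec_swap {Γ₁ Γ₂ : Type*} [Fintype Γ₁] [Fintype Γ₂] (A : Set (Γ₁ × Γ₂))
    (p : Γ₁ × Γ₂ → ℝ) (hp : IsProbVec A p) :
    IsProbVec (Prod.swap ⁻¹' A) (fun z : Γ₂ × Γ₁ => p z.swap) :=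
  ⟨fun z => hp.1 _, fun z hz => hp.2.1 _ hz, (sum_prod_swap p).trans hp.2.2⟩

theorem gOne_nonneg {Γ₁ Γ₂ : Type*} [Fintype Γ₁] [Fintype Γ₂] (A : Set (Γ₁ × Γ₂))
    (p : Γ₁ × Γ₂ → ℝ) (hp : IsProbVec A p) (a : Γ₁ → ℝ) (b : Γ₂ → ℝ)
    (h1 : lyap1 p a ≤ 0) (h2 : lyap2 p b ≤ 0) : 0 ≤ gOne p a b := by
  have e1 := ent1_nonneg p hp.1 hp.2.2
  have e2 := ent2_nonneg p hp.1
  unfold gOne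
  exact add_nonneg (div_nonneg_of_nonpos (by linarith) h1) (div_nonneg_of_nonpos (by linarith) h2)

theorem exists_maximizer {Γ₁ Γ₂ : Type*} [Fintype Γ₁] [Fintype Γ₂] (A : Set (Γ₁ × Γ₂))
    (hA : A.Nonempty) (a : Γ₁ → ℝ) (b : Γ₂ → ℝ) (m : ℝ) (hm : 0 < m)
    (ha : ∀ i, Real.log (a i) ≤ -m) (hb : ∀ i, Real.log (b i) ≤ -m) :
    ∃ p, IsProbVec A p ∧ ∀ p', IsProbVec A p' → gFun p' a b ≤ gFun p a b := by
  classical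
  let S : Set (Γ₁ × Γ₂ → ℝ) := {p | IsProbVec A p}
  have hScl : IsClosed {p : Γ₁ × Γ₂ → ℝ | ∀ ij ∉ A, p ij = 0} := by
    simp only [Set.setOf_forall]
    refine isClosed_iInter fun ij => isClosed_iInter fun _ => ?_
    exact isClosed_eq (continuous_apply ij) continuous_const
  have hS : IsCompact S := by
    have h := (isCompact_stdSimplex ℝ (Γ₁ × Γ₂)).inter_right hScl
    convert h using 1
    ext p
    constructor
    · rintro ⟨h1, h2, h3⟩
      exact ⟨⟨h1, h3⟩, h2⟩
    · rintro ⟨⟨h1, h3⟩, h2⟩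
      exact ⟨h1, h2, h3⟩
  have hSne : S.Nonempty := by
    obtain ⟨z, hz⟩ := hA
    refine ⟨Pi.single z 1, ?_, ?_, ?_⟩
    · intro ij
      by_cases h : ij = z
      · subst h; simp
      · simp [h]
    · intro ij hij
      have : ij ≠ z := fun h => hij (h ▸ hz)
      simp [this]
    · simp
  have hl1 : Continuous fun p : Γ₁ × Γ₂ → ℝ => lyap1 p a := by unfold lyap1; fun_prop
  have hl2 : Continuous fun p : Γ₁ × Γ₂ → ℝ => lyap2 p b := by unfold lyap2; fun_prop
  have hn1 : ∀ p ∈ S, lyap1 p a ≠ 0 := fun p hp =>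
    (lt_of_le_of_lt (lyap1_neg p hp.1 hp.2.2 a _ ha) (by linarith)).ne
  have hn2 : ∀ p ∈ S, lyap2 p b ≠ 0 := fun p hp =>
    (lt_of_le_of_lt (lyap2_neg p hp.1 hp.2.2 b _ hb) (by linarith)).ne
  have hc1 := continuousOn_gOne a b S hn1 hn2
  have hc2 : ContinuousOn (fun p => gTwo p a b) S := by
    have h := continuousOn_gOne b a ((fun p : Γ₁ × Γ₂ → ℝ => fun z : Γ₂ × Γ₁ => p z.swap) '' S)
      (by rintro _ ⟨p, hp, rfl⟩; rw [lyap1_swap]; exact hn2 p hp)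
      (by rintro _ ⟨p, hp, rfl⟩; rw [lyap2_swap]; exact hn1 p hp)
    have h2 := h.comp (f := fun p : Γ₁ × Γ₂ → ℝ => fun z : Γ₂ × Γ₁ => p z.swap) (s := S)
      (by fun_prop) (fun p hp => ⟨p, hp, rfl⟩)
    refine h2.congr fun p _ => ?_
    exact (gOne_swap p a b).symm
  have hcont : ContinuousOn (fun p => gFun p a b) S := by
    have hu : S = (S ∩ {p | lyap2 p b ≤ lyap1 p a}) ∪ (S ∩ {p | lyap1 p a ≤ lyap2 p b}) := by
      ext p
      constructor
      · intro hp
        rcases le_total (lyap2 p b) (lyap1 p a) with h | h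
        · exact Or.inl ⟨hp, h⟩
        · exact Or.inr ⟨hp, h⟩
      · rintro (h | h) <;> exact h.1
    rw [hu]
    refine ContinuousOn.union_of_isClosed ?_ ?_ (hS.isClosed.inter (isClosed_le hl2 hl1))
      (hS.isClosed.inter (isClosed_le hl1 hl2))
    · refine (hc1.mono Set.inter_subset_left).congr fun p hp => ?_
      exact if_pos hp.2
    · refine (hc2.mono Set.inter_subset_left).congr fun p hp => ?_
      simp only [gFun]
      split_ifs with h
      · have h3 : lyap2 p b = lyap1 p a := le_antisymm h hp.2
        unfold gOne gTwo
        rw [h3]; ring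
      · rfl
  obtain ⟨p, hp, hmax⟩ := hS.exists_isMaxOn hSne hcont
  exact ⟨p, hp, fun p' hp' => hmax hp'⟩


/-! ### Conclusion -/

theorem log_norm_le {Λ : Type*} (F : ConformalIFS Λ) (n : ℕ) (i : Fin n → Λ) :
    Real.log (wordDerivNorm F.f F.f' (List.ofFn i)) ≤ n * Real.log F.ratio := by
  have h := wordDerivNorm_le_ratio F (List.ofFn i)
  rw [List.length_ofFn] at h
  rw [← Real.log_pow]
  exact Real.log_le_log (wordDerivNorm_pos F _) h

theorem norm_lt_one {Λ : Type*} (F : ConformalIFS Λ) (n : ℕ) (hn : 1 ≤ n) (i : Fin n → Λ) :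
    wordDerivNorm F.f F.f' (List.ofFn i) < 1 := by
  have h := wordDerivNorm_le_ratio F (List.ofFn i)
  rw [List.length_ofFn] at h
  exact h.trans_lt (pow_lt_one₀ F.ratio_pos.le F.ratio_lt_one (by omega))

theorem gFun_nonneg {Γ₁ Γ₂ : Type*} [Fintype Γ₁] [Fintype Γ₂] (A : Set (Γ₁ × Γ₂))
    (p : Γ₁ × Γ₂ → ℝ) (hp : IsProbVec A p) (a : Γ₁ → ℝ) (b : Γ₂ → ℝ)
    (h1 : lyap1 p a ≤ 0) (h2 : lyap2 p b ≤ 0) : 0 ≤ gFun p a b := by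
  unfold gFun
  split_ifs
  · exact gOne_nonneg A p hp a b h1 h2
  · rw [← gOne_swap]
    exact gOne_nonneg _ _ (probVec_swap A p hp) b a (by rw [lyap1_swap]; exact h2)
      (by rw [lyap2_swap]; exact h1)

theorem lower_gFun {Γ₁ Γ₂ : Type} [Fintype Γ₁] [Fintype Γ₂] (C₁ : CData Γ₁) (C₂ : CData Γ₂)
    (c : ℝ) (hc₁ : Real.log C₁.D ≤ c) (hc₂ : Real.log C₂.D ≤ c) (hc0 : 0 ≤ c)
    (A : Set (Γ₁ × Γ₂)) (X : Set (ℝ × ℝ)) (hXne : X.Nonempty) (hXc : IsCompact X)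
    (hXI : X ⊆ Icc (0:ℝ) 1 ×ˢ Icc (0:ℝ) 1)
    (hX : ∀ γ ∈ A, ∀ z ∈ X, (C₁.φ γ.1 z.1, C₂.φ γ.2 z.2) ∈ X)
    (p : Γ₁ × Γ₂ → ℝ) (hp : IsProbVec A p) (m : ℝ) (hm : 0 < m)
    (h1 : lyap1 p (fun i => C₁.N [i]) ≤ -m) (h2 : lyap2 p (fun i => C₂.N [i]) ≤ -m) :
    ENNReal.ofReal (gFun p (fun i => C₁.N [i]) (fun i => C₂.N [i])) ≤
      ENNReal.ofReal (1 + c / m) * dimH X := by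
  unfold gFun
  split_ifs with h
  · exact lower_bound C₁ C₂ c hc₁ hc₂ hc0 A X hXne hXc.isClosed hXI hX p hp _ _ m hm rfl rfl h1 h
  · rw [← gOne_swap, ← dimH_swap X]
    refine lower_bound C₂ C₁ c hc₂ hc₁ hc0 (Prod.swap ⁻¹' A) (Prod.swap '' X) (hXne.image _)
      (hXc.image continuous_swap).isClosed ?_ ?_ _ (probVec_swap A p hp) _ _ m hm rfl rfl ?_ ?_
    · rintro _ ⟨z, hz, rfl⟩
      exact ⟨(hXI hz).2, (hXI hz).1⟩
    · rintro γ hγ _ ⟨z, hz, rfl⟩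
      exact ⟨_, hX γ.swap hγ z hz, rfl⟩
    · rw [lyap1_swap]; exact h2
    · rw [lyap1_swap, lyap2_swap]; exact (not_le.1 h).le


/-- The Hausdorff dimension of a non-linear carpet with the coordinate open set
condition is the limit of the maxima of `g(p, a_n, b_n)` over probability vectors on `Λⁿ`;
the maximum is attained for each `n ≥ 1`. -/
theorem stmt3 {Λ₁ Λ₂ : Type} [Fintype Λ₁] [Fintype Λ₂] [Nonempty Λ₁] [Nonempty Λ₂]
    (F : ConformalIFS Λ₁) (G : ConformalIFS Λ₂)
    (A : Set (Λ₁ × Λ₂)) (hA : A.Nonempty)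
    (hF : CoordOSC F) (hG : CoordOSC G)
    (X : Set (ℝ × ℝ)) (hX : IsCarpetAttractor F G A X) :
    (∀ n : ℕ, 1 ≤ n → ∃ p, IsProbVec (blockAlphabet A n) p ∧
      ∀ p', IsProbVec (blockAlphabet A n) p' →
        gFun p' (fun i => wordDerivNorm F.f F.f' (List.ofFn i))
            (fun j => wordDerivNorm G.f G.f' (List.ofFn j)) ≤
        gFun p (fun i => wordDerivNorm F.f F.f' (List.ofFn i))
            (fun j => wordDerivNorm G.f G.f' (List.ofFn j))) ∧
    Tendsto (fun n : ℕ => ENNReal.ofReal (sSup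
        {t | ∃ p, IsProbVec (blockAlphabet A n) p ∧
          gFun p (fun i : Fin n → Λ₁ => wordDerivNorm F.f F.f' (List.ofFn i))
            (fun j : Fin n → Λ₂ => wordDerivNorm G.f G.f' (List.ofFn j)) = t}))
      atTop (nhds (dimH X)) := by
  classical
  obtain ⟨a0, ha0, haF, haG⟩ : ∃ a0 : ℝ, 0 < a0 ∧ Real.log F.ratio ≤ -a0 ∧
      Real.log G.ratio ≤ -a0 := by
    have h1 := Real.log_neg F.ratio_pos F.ratio_lt_one
    have h2 := Real.log_neg G.ratio_pos G.ratio_lt_one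
    refine ⟨min (-Real.log F.ratio) (-Real.log G.ratio), lt_min (by linarith) (by linarith), ?_, ?_⟩
    · linarith [min_le_left (-Real.log F.ratio) (-Real.log G.ratio)]
    · linarith [min_le_right (-Real.log F.ratio) (-Real.log G.ratio)]
  have hlF : ∀ n : ℕ, ∀ i : Fin n → Λ₁,
      Real.log (wordDerivNorm F.f F.f' (List.ofFn i)) ≤ -(n * a0) := fun n i => by
    have h := log_norm_le F n i
    have h2 := mul_le_mul_of_nonneg_left haF (Nat.cast_nonneg (α := ℝ) n)
    linarith
  have hlG : ∀ n : ℕ, ∀ i : Fin n → Λ₂,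
      Real.log (wordDerivNorm G.f G.f' (List.ofFn i)) ≤ -(n * a0) := fun n i => by
    have h := log_norm_le G n i
    have h2 := mul_le_mul_of_nonneg_left haG (Nat.cast_nonneg (α := ℝ) n)
    linarith
  have hmpos : ∀ n : ℕ, 1 ≤ n → 0 < (n : ℝ) * a0 := fun n hn =>
    mul_pos (by exact_mod_cast hn) ha0
  have hmax : ∀ n : ℕ, 1 ≤ n → ∃ p, IsProbVec (blockAlphabet A n) p ∧
      ∀ p', IsProbVec (blockAlphabet A n) p' →
        gFun p' (fun i => wordDerivNorm F.f F.f' (List.ofFn i))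
            (fun j => wordDerivNorm G.f G.f' (List.ofFn j)) ≤
        gFun p (fun i => wordDerivNorm F.f F.f' (List.ofFn i))
            (fun j => wordDerivNorm G.f G.f' (List.ofFn j)) := by
    intro n hn
    obtain ⟨z, hz⟩ := hA
    exact exists_maximizer (blockAlphabet A n) ⟨(fun _ => z.1, fun _ => z.2), fun _ => hz⟩ _ _
      (n * a0) (hmpos n hn) (hlF n) (hlG n)
  refine ⟨hmax, ?_⟩
  obtain ⟨D₁, hD₁, hC₁⟩ := exists_CData F hF
  obtain ⟨D₂, hD₂, hC₂⟩ := exists_CData G hG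
  set c := max (Real.log D₁) (Real.log D₂) with hc
  have hc0 : 0 ≤ c := (Real.log_nonneg hD₁).trans (le_max_left _ _)
  obtain ⟨hXne, hXc, hXI, hXeq⟩ := id hX
  set M : ℕ → ℝ := fun n => sSup
        {t | ∃ p, IsProbVec (blockAlphabet A n) p ∧
          gFun p (fun i : Fin n → Λ₁ => wordDerivNorm F.f F.f' (List.ofFn i))
            (fun j : Fin n → Λ₂ => wordDerivNorm G.f G.f' (List.ofFn j)) = t} with hM
  have hboth : ∀ n : ℕ, 1 ≤ n → dimH X ≤ ENNReal.ofReal (M n) ∧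
      ENNReal.ofReal (M n) ≤ ENNReal.ofReal (1 + c / (n * a0)) * dimH X := by
    intro n hn
    obtain ⟨p, hp, hpm⟩ := hmax n hn
    have hMn : M n = gFun p (fun i => wordDerivNorm F.f F.f' (List.ofFn i))
            (fun j => wordDerivNorm G.f G.f' (List.ofFn j)) := by
      refine IsGreatest.csSup_eq ⟨⟨p, hp, rfl⟩, ?_⟩
      rintro _ ⟨p', hp', rfl⟩
      exact hpm p' hp'
    have hy1 := lyap1_neg p hp.1 hp.2.2 _ _ (hlF n)
    have hy2 := lyap2_neg p hp.1 hp.2.2 _ _ (hlG n)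
    have hmp := hmpos n hn
    rw [hMn]
    constructor
    · exact upper_bound (fun i : Fin n → Λ₁ => compWord F.f (List.ofFn i))
        (fun i : Fin n → Λ₂ => compWord G.f (List.ofFn i)) _ _
        (fun i => wordDerivNorm_pos F _) (fun i => norm_lt_one F n hn i)
        (fun i => wordDerivNorm_pos G _) (fun i => norm_lt_one G n hn i)
        (fun i => compWord_mapsTo _ F.mapsTo _) (fun i => compWord_mapsTo _ G.mapsTo _)
        (fun i x hx y hy => compWord_lip F _ x y hx hy)
        (fun i x hx y hy => compWord_lip G _ x y hx hy)
        (blockAlphabet A n) X hXI (block_cover F G A X hX n) _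
        (gFun_nonneg _ p hp _ _ (by linarith) (by linarith)) hpm
    · obtain ⟨C₁, hCD₁, hφ₁, hN₁⟩ := hC₁ n hn
      obtain ⟨C₂, hCD₂, hφ₂, hN₂⟩ := hC₂ n hn
      have e1 : (fun i : Fin n → Λ₁ => wordDerivNorm F.f F.f' (List.ofFn i)) =
        fun i => C₁.N [i] := funext fun i => (hN₁ i).symm
      have e2 : (fun i : Fin n → Λ₂ => wordDerivNorm G.f G.f' (List.ofFn i)) =
        fun i => C₂.N [i] := funext fun i => (hN₂ i).symm
      rw [e1] at hy1 ⊢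
      rw [e2] at hy2 ⊢
      refine lower_gFun C₁ C₂ c (by rw [hCD₁]; exact le_max_left _ _)
        (by rw [hCD₂]; exact le_max_right _ _) hc0 (blockAlphabet A n) X hXne hXc hXI ?_ p hp
        _ hmp hy1 hy2
      rw [hφ₁, hφ₂]
      exact block_inv F G A X hX n
  have hfin : dimH X ≠ ⊤ := ((hboth 1 le_rfl).1.trans_lt ENNReal.ofReal_lt_top).ne
  have hlim : Tendsto (fun n : ℕ => ENNReal.ofReal (1 + c / (n * a0)) * dimH X) atTop
      (nhds (dimH X)) := by
    have h1 : Tendsto (fun n : ℕ => 1 + c / ((n : ℝ) * a0)) atTop (nhds (1 + 0)) := by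
      refine tendsto_const_nhds.add (Tendsto.div_atTop tendsto_const_nhds ?_)
      exact tendsto_natCast_atTop_atTop.atTop_mul_const ha0
    have h2 := ENNReal.Tendsto.mul_const (b := dimH X) (ENNReal.tendsto_ofReal h1) (Or.inr hfin)
    simpa using h2
  refine tendsto_of_tendsto_of_tendsto_of_le_of_le' tendsto_const_nhds hlim ?_ ?_
  · filter_upwards [eventually_ge_atTop 1] with n hn using (hboth n hn).1
  · filter_upwards [eventually_ge_atTop 1] with n hn using (hboth n hn).2

end
end

section
/- Let X be a non-linear carpet. Assume there exist a point (x,y) ∈ X and (i,j) ∈ Λ with |f_i'(x)| ≠ |g_j'(y)|. Then for infinitely many n ∈ ℕ there exists a word w ∈ Λⁿ, with coordinate projections 𝚒 ∈ Λ₁ⁿ and 𝚓 ∈ Λ₂ⁿ, such that ‖f_𝚒'‖ ≠ ‖g_𝚓'‖. -/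
open Set Filter MeasureTheory Metric
open scoped ENNReal NNReal

noncomputable section

section Helpers

variable {L : Type} (F : ConformalIFS L)

lemma cw_mem (w : List L) : ∀ x ∈ Icc (0:ℝ) 1, compWord F.f w x ∈ Icc (0:ℝ) 1 := by
  induction w with
  | nil => intro x hx; exact hx
  | cons i w ih => intro x hx; exact F.mapsTo i (ih x hx)

lemma cw_contr (w : List L) : ∀ x ∈ Icc (0:ℝ) 1, ∀ y ∈ Icc (0:ℝ) 1,
    |compWord F.f w x - compWord F.f w y| ≤ F.ratio ^ w.length := by
  induction w with
  | nil =>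
    intro x hx y hy
    simp only [compWord, id, List.length_nil, pow_zero]
    rw [abs_le]
    constructor <;> linarith [hx.1, hx.2, hy.1, hy.2]
  | cons i w ih =>
    intro x hx y hy
    refine (F.contracting i _ (cw_mem F w x hx) _ (cw_mem F w y hy)).trans ?_
    rw [List.length_cons, pow_succ']
    exact mul_le_mul_of_nonneg_left (ih x hx y hy) F.ratio_pos.le

lemma f'_bdd (i : L) : ∃ C : ℝ, ∀ x ∈ Icc (0:ℝ) 1, |F.f' i x| ≤ C := by
  obtain ⟨C, hC⟩ := F.holder i
  refine ⟨|F.f' i 0| + |C|, fun x hx => ?_⟩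
  have h := hC x hx 0 (by simp)
  have h1 : |x - 0| ^ F.exponent ≤ 1 := by
    apply Real.rpow_le_one (abs_nonneg _) _ F.exponent_pos.le
    rw [sub_zero, abs_of_nonneg hx.1]; exact hx.2
  have h2 : C * |x - 0| ^ F.exponent ≤ |C| * 1 :=
    mul_le_mul (le_abs_self _) h1 (by positivity) (abs_nonneg _)
  have h3 := abs_sub_abs_le_abs_sub (F.f' i x) (F.f' i 0)
  linarith

lemma wd_bdd (w : List L) : ∃ C : ℝ, ∀ x ∈ Icc (0:ℝ) 1, |wordDeriv F.f F.f' w x| ≤ C := by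
  induction w with
  | nil => exact ⟨1, fun x _ => by simp [wordDeriv]⟩
  | cons i w ih =>
    obtain ⟨C, hC⟩ := ih
    obtain ⟨D, hD⟩ := f'_bdd F i
    refine ⟨D * C, fun x hx => ?_⟩
    simp only [wordDeriv, abs_mul]
    have h := hD _ (cw_mem F w x hx)
    exact mul_le_mul h (hC x hx) (abs_nonneg _) ((abs_nonneg _).trans h)

lemma wd_ne (w : List L) : ∀ x ∈ Icc (0:ℝ) 1, wordDeriv F.f F.f' w x ≠ 0 := by
  induction w with
  | nil => intro x _; simp [wordDeriv]
  | cons i w ih =>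
    intro x hx
    exact mul_ne_zero (F.nonvanishing i _ (cw_mem F w x hx)) (ih x hx)

lemma wd_le (w : List L) (x : ℝ) (hx : x ∈ Icc (0:ℝ) 1) :
    |wordDeriv F.f F.f' w x| ≤ wordDerivNorm F.f F.f' w := by
  obtain ⟨C, hC⟩ := wd_bdd F w
  apply le_csSup
  · refine ⟨C, ?_⟩
    rintro _ ⟨y, hy, rfl⟩
    exact hC y hy
  · exact ⟨x, hx, rfl⟩

lemma wdn_le (w : List L) (c : ℝ) (h : ∀ x ∈ Icc (0:ℝ) 1, |wordDeriv F.f F.f' w x| ≤ c) :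
    wordDerivNorm F.f F.f' w ≤ c := by
  apply csSup_le
  · exact ⟨_, 0, by simp, rfl⟩
  · rintro _ ⟨y, hy, rfl⟩
    exact h y hy

lemma wdn_pos (w : List L) : 0 < wordDerivNorm F.f F.f' w :=
  (abs_pos.2 (wd_ne F w 0 (by simp))).trans_le (wd_le F w 0 (by simp))

lemma key (i : L) (x ε : ℝ) (hε : 0 < ε) : ∃ M : ℕ, ∀ w : List L, M ≤ w.length →
    (∃ z ∈ Icc (0:ℝ) 1, compWord F.f w z = x) →
    |wordDerivNorm F.f F.f' (i :: w) - |F.f' i x| * wordDerivNorm F.f F.f' w|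
      ≤ ε * wordDerivNorm F.f F.f' w := by
  obtain ⟨C, hC⟩ := F.holder i
  have hr0 : 0 ≤ F.ratio ^ F.exponent := Real.rpow_nonneg F.ratio_pos.le _
  have hr1 : F.ratio ^ F.exponent < 1 :=
    Real.rpow_lt_one F.ratio_pos.le F.ratio_lt_one F.exponent_pos
  obtain ⟨M, hM⟩ := exists_pow_lt_of_lt_one (show 0 < ε / (|C| + 1) by positivity) hr1
  refine ⟨M, ?_⟩
  rintro w hw ⟨z, hz, rfl⟩
  set a := |F.f' i (compWord F.f w z)| with ha
  have hcl : ∀ y ∈ Icc (0:ℝ) 1, abs (|F.f' i (compWord F.f w y)| - a) ≤ ε := by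
    intro y hy
    refine (abs_abs_sub_abs_le _ _).trans ?_
    refine (hC _ (cw_mem F w y hy) _ (cw_mem F w z hz)).trans ?_
    have h1 : |compWord F.f w y - compWord F.f w z| ^ F.exponent
        ≤ ε / (|C| + 1) := by
      refine (Real.rpow_le_rpow (abs_nonneg _) (cw_contr F w y hy z hz) F.exponent_pos.le).trans ?_
      rw [← Real.rpow_natCast, ← Real.rpow_mul F.ratio_pos.le, mul_comm,
        Real.rpow_mul F.ratio_pos.le, Real.rpow_natCast]
      exact (pow_le_pow_of_le_one hr0 hr1.le hw).trans hM.le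
    calc _ ≤ (|C| + 1) * (ε / (|C| + 1)) :=
          mul_le_mul ((le_abs_self C).trans (by linarith)) h1 (by positivity) (by positivity)
      _ = ε := by field_simp
  have hN := wdn_pos F w
  have hN' := wdn_pos F (i :: w)
  rw [abs_le]
  constructor
  · by_cases hae : a - ε ≤ 0
    · nlinarith
    · push Not at hae
      have : wordDerivNorm F.f F.f' w ≤ wordDerivNorm F.f F.f' (i :: w) / (a - ε) := by
        apply wdn_le
        intro y hy
        rw [le_div_iff₀ hae]
        have h1 := wd_le F (i :: w) y hy
        simp only [wordDeriv, abs_mul] at h1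
        have h2 := (abs_le.1 (hcl y hy)).1
        nlinarith [abs_nonneg (wordDeriv F.f F.f' w y)]
      rw [le_div_iff₀ hae] at this
      nlinarith
  · have : wordDerivNorm F.f F.f' (i :: w) ≤ (a + ε) * wordDerivNorm F.f F.f' w := by
      apply wdn_le
      intro y hy
      simp only [wordDeriv, abs_mul]
      have h2 := (abs_le.1 (hcl y hy)).2
      have h0 : 0 ≤ a := abs_nonneg _
      exact mul_le_mul (by linarith) (wd_le F w y hy) (abs_nonneg _) (by linarith)
    linarith

end Helpers

lemma exists_code {Λ₁ Λ₂ : Type} (F : ConformalIFS Λ₁) (G : ConformalIFS Λ₂)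
    (A : Set (Λ₁ × Λ₂)) (X : Set (ℝ × ℝ)) (hX : IsCarpetAttractor F G A X) (n : ℕ) :
    ∀ p ∈ X, ∃ w : List (Λ₁ × Λ₂), w.length = n ∧ (∀ a ∈ w, a ∈ A) ∧ ∃ q ∈ X,
      compWord F.f (w.map Prod.fst) q.1 = p.1 ∧ compWord G.f (w.map Prod.snd) q.2 = p.2 := by
  induction n with
  | zero => intro p hp; exact ⟨[], rfl, by simp, p, hp, rfl, rfl⟩
  | succ n ih =>
    intro p hp
    rw [hX.2.2.2] at hp
    simp only [mem_iUnion] at hp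
    obtain ⟨ij, hij, p', hp', rfl⟩ := hp
    obtain ⟨w, hw, hwA, q, hq, h1, h2⟩ := ih p' hp'
    refine ⟨ij :: w, by simp [hw], ?_, q, hq, ?_, ?_⟩
    · intro a ha
      rcases List.mem_cons.1 ha with rfl | h
      · exact hij
      · exact hwA a h
    · simp [compWord, h1, carpetMap]
    · simp [compWord, h2, carpetMap]

/-- If the coordinate derivatives differ in modulus at some point of the carpet
for some letter, then for infinitely many `n` there is a word in `Λⁿ` whose two coordinate
derivative sup-norms differ. -/
theorem stmt8 {Λ₁ Λ₂ : Type} [Fintype Λ₁] [Fintype Λ₂] [Nonempty Λ₁] [Nonempty Λ₂]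
    (F : ConformalIFS Λ₁) (G : ConformalIFS Λ₂)
    (A : Set (Λ₁ × Λ₂)) (hA : A.Nonempty)
    (X : Set (ℝ × ℝ)) (hX : IsCarpetAttractor F G A X)
    (hpt : ∃ x y : ℝ, (x, y) ∈ X ∧ ∃ ij ∈ A, |F.f' ij.1 x| ≠ |G.f' ij.2 y|) :
    {n : ℕ | ∃ w ∈ blockAlphabet A n,
      wordDerivNorm F.f F.f' (List.ofFn w.1) ≠ wordDerivNorm G.f G.f' (List.ofFn w.2)}.Infinite := by
  intro hfin
  obtain ⟨x, y, hxy, ij, hij, hne⟩ := hpt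
  apply hne
  obtain ⟨B, hB⟩ := hfin.bddAbove
  have heq : ∀ w : List (Λ₁ × Λ₂), B < w.length → (∀ a ∈ w, a ∈ A) →
      wordDerivNorm F.f F.f' (w.map Prod.fst) = wordDerivNorm G.f G.f' (w.map Prod.snd) := by
    intro w hw hwA
    by_contra h
    refine absurd (hB (a := w.length) ?_) (not_le.2 hw)
    refine ⟨(fun k => (w.get k).1, fun k => (w.get k).2), fun k => hwA _ (List.get_mem _ _), ?_⟩
    have e1 : List.ofFn (fun k => (w.get k).1) = w.map Prod.fst := by
      conv_rhs => rw [← List.ofFn_get w, List.map_ofFn]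
      rfl
    have e2 : List.ofFn (fun k => (w.get k).2) = w.map Prod.snd := by
      conv_rhs => rw [← List.ofFn_get w, List.map_ofFn]
      rfl
    simp only [e1, e2]
    exact h
  refine eq_of_abs_sub_le_all fun ε hε => ?_
  obtain ⟨M₁, h₁⟩ := key F ij.1 x (ε / 2) (half_pos hε)
  obtain ⟨M₂, h₂⟩ := key G ij.2 y (ε / 2) (half_pos hε)
  obtain ⟨w, hw, hwA, q, hq, hq1, hq2⟩ := exists_code F G A X hX (M₁ + M₂ + B + 1) _ hxy
  have hqI := hX.2.2.1 hq
  have k1 := h₁ (w.map Prod.fst) (by rw [List.length_map]; omega) ⟨q.1, hqI.1, hq1⟩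
  have k2 := h₂ (w.map Prod.snd) (by rw [List.length_map]; omega) ⟨q.2, hqI.2, hq2⟩
  have e1 := heq w (by omega) hwA
  have e2 := heq (ij :: w) (by rw [List.length_cons]; omega) (by
    intro a ha
    rcases List.mem_cons.1 ha with rfl | h
    · exact hij
    · exact hwA a h)
  simp only [List.map_cons] at e2
  rw [e1, e2] at k1
  have hN := wdn_pos G (w.map Prod.snd)
  rw [abs_le] at k1 k2 ⊢
  constructor
  · refine le_of_mul_le_mul_right ?_ hN
    linarith [k1.1, k1.2, k2.1, k2.2]
  · refine le_of_mul_le_mul_right ?_ hN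
    linarith [k1.1, k1.2, k2.1, k2.2]

end
end
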